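/- arXiv:2110.02575 — 3 statements merged into one kernel-verified Lean document; each statement's English description precedes it below -/
import Mathlib

section
/- For all integers a, b ≥ 0 one has: t(0,b) = (q−1)(q^{b+1}−1), and t(a,b) = (q−1)^2 q^{a+b} whenever a ≥ 1. -/
open MvPolynomial

/-- The set `T(a,b)` of pairs `(J, L)` of nonzero homogeneous polynomials in `F[X,Y]`
of degrees `a` and `b` respectively, which are relatively prime (every common divisor
is a unit) and such that `X` does not divide `J`. -/
def wplT (F : Type*) [Field F] (a b : ℕ) :
    Set (MvPolynomial (Fin 2) F × MvPolynomial (Fin 2) F) :=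
  {P | P.1 ≠ 0 ∧ P.2 ≠ 0 ∧ P.1.IsHomogeneous a ∧ P.2.IsHomogeneous b ∧
    IsRelPrime P.1 P.2 ∧ ¬ (X 0 ∣ P.1)}

namespace Polynomial

section Homogenize

variable {F : Type*} [Field F]

lemma natDegree_aeval_X_one_le {J : MvPolynomial (Fin 2) F} {a : ℕ} (hJ : J.IsHomogeneous a) :
    (MvPolynomial.aeval ![(X : Polynomial F), 1] J).natDegree ≤ a := by
  rw [J.as_sum, map_sum]
  refine natDegree_sum_le_of_forall_le _ _ fun m hm ↦ ?_
  obtain rfl : m.weight 1 = a := hJ <| by simpa using hm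
  rw [MvPolynomial.aeval_monomial, ← C_eq_algebraMap]
  refine (natDegree_C_mul_le _ _).trans ?_
  simp [Finsupp.prod_fintype, Finsupp.weight_apply, Finsupp.sum_fintype, Fin.prod_univ_two,
    Fin.sum_univ_two]

lemma X_one_dvd_homogenize_iff {p : Polynomial F} {a : ℕ} (hp : p.natDegree ≤ a) (hp0 : p ≠ 0) :
    MvPolynomial.X 1 ∣ p.homogenize a ↔ p.natDegree < a := by
  constructor
  · rintro ⟨K, hK⟩
    refine lt_of_le_of_ne hp fun h ↦ hp0 ?_
    have h1 := congrArg (MvPolynomial.coeff (Finsupp.single 0 a)) hK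
    rw [coeff_homogenize, MvPolynomial.coeff_X_mul'] at h1
    simpa [← h] using h1
  · intro h
    obtain ⟨c, rfl⟩ := Nat.exists_eq_add_of_lt h
    have h1 := homogenize_mul p 1 (m := p.natDegree + c) (n := 1) (by omega) (by simp)
    rw [mul_one] at h1
    rw [h1]
    simp

lemma isRelPrime_homogenize_iff {p r : Polynomial F} {a b : ℕ} (hp : p.natDegree = a)
    (hp0 : p ≠ 0) (hr : r.natDegree ≤ b) (hr0 : r ≠ 0) :
    IsRelPrime (p.homogenize a) (r.homogenize b) ↔ IsCoprime p r := by
  constructor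
  · intro h
    refine IsRelPrime.isCoprime fun d ⟨j, hj⟩ ⟨l, hl⟩ ↦ ?_
    have hd : d ≠ 0 := by rintro rfl; simp_all
    have hj0 : j ≠ 0 := by rintro rfl; simp_all
    have hl0 : l ≠ 0 := by rintro rfl; simp_all
    have ha : d.natDegree + j.natDegree = a := by rw [← hp, hj, natDegree_mul hd hj0]
    have hb : d.natDegree + l.natDegree ≤ b := by rwa [hl, natDegree_mul hd hl0] at hr
    obtain ⟨c, rfl⟩ := Nat.exists_eq_add_of_le hb
    have hu : IsUnit (d.homogenize d.natDegree) := by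
      refine h ?_ ?_
      · rw [hj, ← ha, homogenize_mul d j le_rfl le_rfl]
        exact dvd_mul_right _ _
      · rw [hl, add_assoc, homogenize_mul d l le_rfl (by omega)]
        exact dvd_mul_right _ _
    simpa using hu.map (MvPolynomial.aeval ![(X : Polynomial F), 1])
  · rintro ⟨u, v, huv⟩ D hDp hDr
    set N := u.natDegree + v.natDegree + a + b with hN
    have hX : D ∣ MvPolynomial.X 1 ^ N := by
      have h1 := congrArg (homogenize · N) huv
      simp only [homogenize_add, homogenize_one] at h1
      rw [← h1]
      refine dvd_add ?_ ?_
      · rw [show N = (u.natDegree + v.natDegree + b) + a by omega,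
          homogenize_mul u p (by omega) hp.le]
        exact hDp.mul_left _
      · rw [show N = (u.natDegree + v.natDegree + a) + b by omega,
          homogenize_mul v r (by omega) hr]
        exact hDr.mul_left _
    obtain ⟨i, -, hi⟩ := (dvd_prime_pow MvPolynomial.X_prime N).1 hX
    rcases Nat.eq_zero_or_pos i with rfl | hi0
    · rw [pow_zero] at hi
      exact associated_one_iff_isUnit.1 hi
    · have := (X_one_dvd_homogenize_iff hp.le hp0).1
        (((dvd_pow_self _ hi0.ne').trans hi.symm.dvd).trans hDp)
      omega

end Homogenize

section Pairs

variable (F : Type*) [Field F]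

/-- Pairs of nonzero polynomials, the first of degree `a` and the second of degree at most `b`. -/
def degreePairs (a b : ℕ) : Set (Polynomial F × Polynomial F) :=
  {P | P.1 ≠ 0 ∧ P.1.natDegree = a ∧ P.2 ≠ 0 ∧ P.2.natDegree ≤ b}

/-- The coprime pairs in `degreePairs F a b`. -/
def coprimePairs (a b : ℕ) : Set (Polynomial F × Polynomial F) :=
  {P | P ∈ degreePairs F a b ∧ IsCoprime P.1 P.2}

/-- Triples `(g, j, l)` with `g` monic, `j` and `l` coprime, and `(g * j, g * l)` in
`degreePairs F a b`. -/
def gcdTriples (a b : ℕ) : Set (Polynomial F × Polynomial F × Polynomial F) :=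
  {T | T.1.Monic ∧ T.2.1 ≠ 0 ∧ T.2.2 ≠ 0 ∧ IsCoprime T.2.1 T.2.2 ∧
    T.1.natDegree + T.2.1.natDegree = a ∧ T.1.natDegree + T.2.2.natDegree ≤ b}

variable {F}

lemma monic_eq_of_mul_eq {g g' j j' l l' : Polynomial F} (hg : g.Monic) (hg' : g'.Monic)
    (h : IsCoprime j l) (h' : IsCoprime j' l') (hj : g * j = g' * j') (hl : g * l = g' * l') :
    g = g' := by
  obtain ⟨u, v, huv⟩ := h
  obtain ⟨u', v', huv'⟩ := h'
  refine eq_of_monic_of_associated hg hg' (associated_of_dvd_dvd ?_ ?_)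
  · exact ⟨u' * j + v' * l, by linear_combination (-g') * huv' - u' * hj - v' * hl⟩
  · exact ⟨u * j' + v * l', by linear_combination (-g) * huv + u * hj + v * hl⟩

lemma exists_monic_mul_isCoprime {p r : Polynomial F} (hp : p ≠ 0) :
    ∃ g j l : Polynomial F, g.Monic ∧ IsCoprime j l ∧ p = g * j ∧ r = g * l := by
  classical
  set d := EuclideanDomain.gcd p r with hd
  have hd0 : d ≠ 0 := fun h ↦ hp (EuclideanDomain.gcd_eq_zero_iff.1 h).1
  obtain ⟨j, hj⟩ := EuclideanDomain.gcd_dvd_left p r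
  obtain ⟨l, hl⟩ := EuclideanDomain.gcd_dvd_right p r
  rw [← hd] at hj hl
  have hc : d.leadingCoeff ≠ 0 := leadingCoeff_ne_zero.2 hd0
  have hcc : C d.leadingCoeff⁻¹ * C d.leadingCoeff = 1 := by
    rw [← C_mul, inv_mul_cancel₀ hc, C_1]
  have hu : IsUnit (C d.leadingCoeff) := isUnit_C.2 hc.isUnit
  refine ⟨d * C d.leadingCoeff⁻¹, C d.leadingCoeff * j, C d.leadingCoeff * l,
    monic_mul_leadingCoeff_inv hd0, ?_, ?_, ?_⟩
  · rw [isCoprime_mul_unit_left hu]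
    refine ⟨EuclideanDomain.gcdA p r, EuclideanDomain.gcdB p r, mul_left_cancel₀ hd0 ?_⟩
    have := EuclideanDomain.gcd_eq_gcd_ab p r
    rw [← hd] at this
    linear_combination (-EuclideanDomain.gcdA p r) * hj - (EuclideanDomain.gcdB p r) * hl - this
  · linear_combination hj - d * j * hcc
  · linear_combination hl - d * l * hcc

lemma ncard_gcdTriples (a b : ℕ) : (gcdTriples F a b).ncard = (degreePairs F a b).ncard := by
  refine Set.ncard_congr (fun T _ ↦ (T.1 * T.2.1, T.1 * T.2.2)) ?_ ?_ ?_
  · rintro ⟨g, j, l⟩ ⟨hg, hj, hl, -, ha, hb⟩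
    refine ⟨mul_ne_zero hg.ne_zero hj, ?_, mul_ne_zero hg.ne_zero hl, ?_⟩
    · simpa [natDegree_mul hg.ne_zero hj] using ha
    · simpa [natDegree_mul hg.ne_zero hl] using hb
  · rintro ⟨g, j, l⟩ ⟨g', j', l'⟩ ⟨hg, -, -, h, -, -⟩ ⟨hg', -, -, h', -, -⟩ heq
    simp only [Prod.mk.injEq] at heq hg hg' h h'
    obtain rfl := monic_eq_of_mul_eq hg hg' h h' heq.1 heq.2
    simp [mul_left_cancel₀ hg.ne_zero heq.1, mul_left_cancel₀ hg.ne_zero heq.2]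
  · rintro ⟨p, r⟩ ⟨hp, ha, hr, hb⟩
    simp only at hp ha hr hb
    obtain ⟨g, j, l, hg, h, rfl, rfl⟩ := exists_monic_mul_isCoprime (r := r) hp
    have hj := right_ne_zero_of_mul hp
    have hl := right_ne_zero_of_mul hr
    rw [natDegree_mul hg.ne_zero hj] at ha
    rw [natDegree_mul hg.ne_zero hl] at hb
    exact ⟨(g, j, l), ⟨hg, hj, hl, h, ha, hb⟩, rfl⟩

lemma degreePairs_eq (a b : ℕ) : degreePairs F a b =
    ((degreeLT F (a + 1) : Set (Polynomial F)) \ degreeLT F a) ×ˢ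
      ((degreeLT F (b + 1) : Set (Polynomial F)) \ {0}) := by
  ext ⟨p, r⟩
  simp only [degreePairs, Set.mem_ofPred_eq, Set.mem_prod, Set.mem_sdiff, SetLike.mem_coe,
    mem_degreeLT, Set.mem_singleton_iff]
  by_cases hp : p = 0
  · simp [hp]
  by_cases hr : r = 0
  · simp [hr]
  rw [← natDegree_lt_iff_degree_lt hp, ← natDegree_lt_iff_degree_lt hp,
    ← natDegree_lt_iff_degree_lt hr]
  simp only [hp, hr, ne_eq, not_false_eq_true, true_and, and_true]
  omega

lemma gcdTriples_succ_eq (a b : ℕ) : gcdTriples F (a + 1) (b + 1) =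
    Prod.mk 1 '' coprimePairs F (a + 1) (b + 1) ∪
      (fun x : F × Polynomial F × Polynomial F × Polynomial F ↦ (x.2.1 * X + C x.1, x.2.2)) ''
        (Set.univ ×ˢ gcdTriples F a b) := by
  ext ⟨g, j, l⟩
  constructor
  · rintro ⟨hg, hj, hl, h, ha, hb⟩
    simp only at hg hj hl h ha hb
    rcases Nat.eq_zero_or_pos g.natDegree with h0 | h0
    · obtain rfl := hg.natDegree_eq_zero.1 h0
      left
      refine ⟨(j, l), ⟨⟨hj, ?_, hl, ?_⟩, h⟩, rfl⟩
      · simpa using ha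
      · simpa using hb
    · right
      refine ⟨(g.coeff 0, g.divX, j, l), ⟨trivial, ?_, hj, hl, h, ?_, ?_⟩, ?_⟩
      · rw [Monic, leadingCoeff, natDegree_divX_eq_natDegree_tsub_one, coeff_divX,
          Nat.sub_add_cancel h0]
        exact hg
      · simp only [natDegree_divX_eq_natDegree_tsub_one]
        omega
      · simp only [natDegree_divX_eq_natDegree_tsub_one]
        omega
      · simp [divX_mul_X_add]
  · rintro (⟨⟨j', l'⟩, ⟨⟨hj, ha, hl, hb⟩, h⟩, heq⟩ |
      ⟨⟨c, g', j', l'⟩, ⟨-, hg, hj, hl, h, ha, hb⟩, heq⟩)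
    · simp only [Prod.mk.injEq] at heq
      obtain ⟨rfl, rfl, rfl⟩ := heq
      exact ⟨monic_one, hj, hl, h, by simpa using ha, by simpa using hb⟩
    · simp only [Prod.mk.injEq] at heq
      obtain ⟨rfl, rfl, rfl⟩ := heq
      simp only at hg hj hl h ha hb
      have hd : (g' * X + C c).natDegree = g'.natDegree + 1 := by
        rw [natDegree_add_C, natDegree_mul_X hg.ne_zero]
      refine ⟨?_, hj, hl, h, ?_, ?_⟩
      · rw [Monic, leadingCoeff, hd, coeff_add, coeff_mul_X, coeff_C_succ, add_zero]
        exact hg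
      · simp only [hd]; omega
      · simp only [hd]; omega

lemma coprimePairs_zero_left (b : ℕ) : coprimePairs F 0 b = degreePairs F 0 b := by
  refine Set.Subset.antisymm (fun _ h ↦ h.1) fun P h ↦ ⟨h, ?_⟩
  have hu : IsUnit P.1 :=
    isUnit_iff_degree_eq_zero.2 (by rw [degree_eq_natDegree h.1, h.2.1]; rfl)
  exact isCoprime_one_left.of_isCoprime_of_dvd_left hu.dvd

lemma coprimePairs_zero_right (a : ℕ) : coprimePairs F a 0 = degreePairs F a 0 := by
  refine Set.Subset.antisymm (fun _ h ↦ h.1) fun P h ↦ ⟨h, ?_⟩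
  have h0 : P.2.natDegree = 0 := Nat.le_zero.1 h.2.2.2
  have hu : IsUnit P.2 :=
    isUnit_iff_degree_eq_zero.2 (by rw [degree_eq_natDegree h.2.2.1, h0]; rfl)
  exact isCoprime_one_right.of_isCoprime_of_dvd_right hu.dvd

variable [Fintype F]

lemma ncard_degreeLT (n : ℕ) :
    (degreeLT F n : Set (Polynomial F)).ncard = Fintype.card F ^ n := by
  rw [← Nat.card_coe_set_eq, SetLike.coe_sort_coe, Nat.card_congr (degreeLTEquiv F n).toEquiv]
  simp

lemma finite_degreeLT (n : ℕ) : (degreeLT F n : Set (Polynomial F)).Finite :=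
  Set.finite_of_ncard_ne_zero (by rw [ncard_degreeLT]; positivity)

lemma finite_degreePairs (a b : ℕ) : (degreePairs F a b).Finite := by
  rw [degreePairs_eq]
  exact ((finite_degreeLT _).sdiff).prod ((finite_degreeLT _).sdiff)

lemma ncard_degreePairs (a b : ℕ) : (degreePairs F a b).ncard =
    (Fintype.card F ^ (a + 1) - Fintype.card F ^ a) * (Fintype.card F ^ (b + 1) - 1) := by
  rw [degreePairs_eq, Set.ncard_prod,
    Set.ncard_sdiff (degreeLT_mono (Nat.le_succ a)) (finite_degreeLT a),
    Set.ncard_sdiff (by simp) (Set.finite_singleton _)]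
  simp [ncard_degreeLT]

lemma ncard_degreePairs_succ (a b : ℕ) : (degreePairs F (a + 1) (b + 1)).ncard =
    (coprimePairs F (a + 1) (b + 1)).ncard + Fintype.card F * (degreePairs F a b).ncard := by
  have hinj : Function.Injective (fun x : F × Polynomial F × Polynomial F × Polynomial F ↦
      (x.2.1 * X + C x.1, x.2.2)) := by
    rintro ⟨c, g, P⟩ ⟨c', g', P'⟩ heq
    simp only [Prod.mk.injEq] at heq
    have hc : c = c' := by simpa using congrArg (coeff · 0) heq.1
    have hg : g = g' := by
      rw [hc] at heq
      exact mul_right_cancel₀ X_ne_zero (add_right_cancel heq.1)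
    rw [hc, hg, heq.2]
  have hfin : (gcdTriples F (a + 1) (b + 1)).Finite := by
    refine Set.finite_of_ncard_ne_zero ?_
    rw [ncard_gcdTriples]
    exact Set.ncard_ne_zero_of_mem (a := (X ^ (a + 1), 1))
      ⟨by simp, by simp, by simp, by simp⟩ (finite_degreePairs _ _)
  rw [gcdTriples_succ_eq, Set.finite_union] at hfin
  rw [← ncard_gcdTriples, gcdTriples_succ_eq, Set.ncard_union_eq ?_ hfin.1 hfin.2,
    Set.ncard_image_of_injective _ (Prod.mk_right_injective _),
    Set.ncard_image_of_injective _ hinj, Set.ncard_prod, ncard_gcdTriples, Set.ncard_univ,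
    Nat.card_eq_fintype_card]
  rw [Set.disjoint_left]
  rintro _ ⟨P, -, rfl⟩ ⟨⟨c, g, P'⟩, ⟨-, hg, -⟩, heq⟩
  have := congrArg natDegree (congrArg Prod.fst heq)
  simp [natDegree_mul_X hg.ne_zero] at this

lemma ncard_coprimePairs_zero_left (b : ℕ) : (coprimePairs F 0 b).ncard =
    (Fintype.card F - 1) * (Fintype.card F ^ (b + 1) - 1) := by
  simp [coprimePairs_zero_left, ncard_degreePairs]

lemma ncard_coprimePairs_succ_left (a b : ℕ) : (coprimePairs F (a + 1) b).ncard =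
    (Fintype.card F - 1) ^ 2 * Fintype.card F ^ (a + 1 + b) := by
  obtain ⟨n, hn⟩ : ∃ n, Fintype.card F = n + 1 :=
    Nat.exists_eq_succ_of_ne_zero Fintype.card_ne_zero
  have hsub (k : ℕ) : (n + 1) ^ (k + 1) - (n + 1) ^ k = (n + 1) ^ k * n := by
    rw [pow_succ, mul_add, mul_one, Nat.add_sub_cancel]
  cases b with
  | zero =>
    rw [coprimePairs_zero_right, ncard_degreePairs, hn, hsub]
    simp
    ring
  | succ b =>
    have h := ncard_degreePairs_succ (F := F) a b
    rw [ncard_degreePairs, ncard_degreePairs, hn, hsub, hsub] at h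
    rw [hn, Nat.add_sub_cancel]
    have h1 : 1 ≤ (n + 1) ^ (b + 1) := Nat.one_le_pow _ _ (by omega)
    have h2 : 1 ≤ (n + 1) ^ (b + 1 + 1) := Nat.one_le_pow _ _ (by omega)
    zify [h1, h2] at h ⊢
    linear_combination -h

end Pairs

end Polynomial

/-- Exchanging the two variables and dehomogenizing turns `wplT F a b` into pairs of coprime
univariate polynomials. -/
lemma wplT_eq_image (F : Type*) [Field F] (a b : ℕ) :
    wplT F a b = (fun P ↦ (renameEquiv F (Equiv.swap 0 1) (P.1.homogenize a),
      renameEquiv F (Equiv.swap 0 1) (P.2.homogenize b))) '' Polynomial.coprimePairs F a b := by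
  set e := renameEquiv F (Equiv.swap (0 : Fin 2) 1) with he
  have heX : e (X 1) = X 0 := by simp [he]
  have hhom (J : MvPolynomial (Fin 2) F) (n : ℕ) : (e J).IsHomogeneous n ↔ J.IsHomogeneous n :=
    IsHomogeneous.rename_isHomogeneous_iff (Equiv.injective _)
  have hrel (J L : MvPolynomial (Fin 2) F) : IsRelPrime (e J) (e L) ↔ IsRelPrime J L := by
    refine ⟨IsRelPrime.of_map e, fun h ↦ IsRelPrime.of_map e.symm ?_⟩
    simpa using h
  have hdvd (J : MvPolynomial (Fin 2) F) : X 0 ∣ e J ↔ X 1 ∣ J := by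
    rw [← heX, map_dvd_iff]
  ext ⟨J, L⟩
  constructor
  · intro h
    obtain ⟨J, rfl⟩ := e.surjective J
    obtain ⟨L, rfl⟩ := e.surjective L
    simp only [wplT, Set.mem_ofPred_eq, hhom, hrel, hdvd, ne_eq, EmbeddingLike.map_eq_zero_iff] at h
    obtain ⟨hJ0, hL0, hJ, hL, h, hX⟩ := h
    have hj := Polynomial.natDegree_aeval_X_one_le hJ
    have hl := Polynomial.natDegree_aeval_X_one_le hL
    have hJj := Polynomial.homogenize_eq_of_isHomogeneous hJ rfl
    have hLl := Polynomial.homogenize_eq_of_isHomogeneous hL rfl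
    set j := aeval ![(Polynomial.X : Polynomial F), 1] J
    set l := aeval ![(Polynomial.X : Polynomial F), 1] L
    have hj0 : j ≠ 0 := fun h ↦ hJ0 (by rw [← hJj, h, Polynomial.homogenize_zero])
    have hl0 : l ≠ 0 := fun h ↦ hL0 (by rw [← hLl, h, Polynomial.homogenize_zero])
    rw [← hJj, Polynomial.X_one_dvd_homogenize_iff hj hj0] at hX
    have hja : j.natDegree = a := by omega
    rw [← hJj, ← hLl, Polynomial.isRelPrime_homogenize_iff hja hj0 hl hl0] at h
    exact ⟨(j, l), ⟨⟨hj0, hja, hl0, hl⟩, h⟩, by simp [hJj, hLl]⟩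
  · rintro ⟨⟨j, l⟩, ⟨⟨hj0, hja, hl0, hl⟩, h⟩, heq⟩
    simp only [Prod.mk.injEq] at heq hj0 hja hl0 hl h
    obtain ⟨rfl, rfl⟩ := heq
    simp only [wplT, Set.mem_ofPred_eq, hhom, hrel, hdvd, ne_eq, EmbeddingLike.map_eq_zero_iff,
      Polynomial.homogenize_eq_zero_iff hja.le, Polynomial.homogenize_eq_zero_iff hl,
      Polynomial.isRelPrime_homogenize_iff hja hj0 hl hl0,
      Polynomial.X_one_dvd_homogenize_iff hja.le hj0]
    exact ⟨hj0, hl0, Polynomial.isHomogeneous_homogenize _, Polynomial.isHomogeneous_homogenize _,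
      h, by omega⟩

lemma wplT_ncard_eq_ncard_coprimePairs (F : Type*) [Field F] (a b : ℕ) :
    (wplT F a b).ncard = (Polynomial.coprimePairs F a b).ncard := by
  rw [wplT_eq_image]
  refine Set.InjOn.ncard_image ?_
  rintro ⟨j, l⟩ ⟨⟨-, hj, -, hl⟩, -⟩ ⟨j', l'⟩ ⟨⟨-, hj', -, hl'⟩, -⟩ heq
  simp only [Prod.mk.injEq, EmbeddingLike.apply_eq_iff_eq] at heq hj hj' hl hl'
  have h1 := congrArg (aeval ![(Polynomial.X : Polynomial F), 1]) heq.1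
  have h2 := congrArg (aeval ![(Polynomial.X : Polynomial F), 1]) heq.2
  rw [Polynomial.aeval_homogenize_X_one _ hj.le, Polynomial.aeval_homogenize_X_one _ hj'.le] at h1
  rw [Polynomial.aeval_homogenize_X_one _ hl, Polynomial.aeval_homogenize_X_one _ hl'] at h2
  rw [h1, h2]

/-- Sublemma A.1 (`𝔱(a,b)`): for a finite field `F` with `q` elements,
`t(0,b) = (q-1)(q^{b+1}-1)` and `t(a,b) = (q-1)^2 q^{a+b}` for `a ≥ 1`. -/
theorem wplT_ncard (F : Type*) [Field F] [Fintype F] (q : ℕ) (hq : Fintype.card F = q)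
    (a b : ℕ) :
    (wplT F 0 b).ncard = (q - 1) * (q ^ (b + 1) - 1) ∧
    (1 ≤ a → (wplT F a b).ncard = (q - 1) ^ 2 * q ^ (a + b)) := by
  subst hq
  refine ⟨?_, fun ha ↦ ?_⟩
  · rw [wplT_ncard_eq_ncard_coprimePairs, Polynomial.ncard_coprimePairs_zero_left]
  · obtain ⟨a, rfl⟩ := Nat.exists_eq_add_of_le' ha
    rw [wplT_ncard_eq_ncard_coprimePairs, Polynomial.ncard_coprimePairs_succ_left]
end

section
/- Let Γ = T_{p_1,…,p_t} be a star-shaped graph and ĩU^Dr the universal ıquantum loop algebra of its simply-laced GCM. Then for every integer a, ĩU^Dr is generated as a ℚ(v)-algebra by the elements B_{⋆,a}, B_{⋆,a+1}, B_{μ,0} for all μ ∈ 𝕀∖{⋆}, K_μ^{±1} for all μ ∈ 𝕀, and C^{±1}. -/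
noncomputable section

/-- The base field `ℚ(v)` of rational functions in `v` over `ℚ`. -/
abbrev Kv : Type := RatFunc ℚ

/-- The element `v` of `ℚ(v)`. -/
def vv : Kv := RatFunc.X

/-- The quantum integer `[r] = (v^r - v^{-r})/(v - v⁻¹)`. -/
def qint (r : ℤ) : Kv := (vv ^ r - vv ^ (-r)) / (vv - vv⁻¹)

/-- Generators of the universal ıquantum loop algebra: `K_μ^{±1}`, `C^{±1}`,
`H_{μ,m}` (`m ≥ 1`, where `Gen.H μ n` stands for `H_{μ,n+1}`) and `B_{μ,l}` (`l ∈ ℤ`). -/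
inductive Gen (I : Type) : Type
  | K : I → Gen I
  | Kinv : I → Gen I
  | C : Gen I
  | Cinv : Gen I
  | H : I → ℕ → Gen I
  | B : I → ℤ → Gen I

/-- The free algebra over `ℚ(v)` on the generators. -/
abbrev FA (I : Type) : Type := FreeAlgebra Kv (Gen I)

variable {I : Type}

/-- `K_μ` -/
def gK (μ : I) : FA I := FreeAlgebra.ι Kv (Gen.K μ)

/-- `K_μ⁻¹` -/
def gKinv (μ : I) : FA I := FreeAlgebra.ι Kv (Gen.Kinv μ)

/-- `C` -/
def gC : FA I := FreeAlgebra.ι Kv Gen.C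

/-- `C⁻¹` -/
def gCinv : FA I := FreeAlgebra.ι Kv Gen.Cinv

/-- `H_{μ,m}` for `m ≥ 1`. -/
def gH (μ : I) (m : ℕ) : FA I := FreeAlgebra.ι Kv (Gen.H μ (m - 1))

/-- `B_{μ,l}`. -/
def gB (μ : I) (l : ℤ) : FA I := FreeAlgebra.ι Kv (Gen.B μ l)

/-- `C^k` for `k : ℤ`, using the formal inverse generator for negative exponents. -/
def gCpow (k : ℤ) : FA I := if 0 ≤ k then gC ^ k.toNat else gCinv ^ (-k).toNat

/-- `Θ_{μ,m}`: zero for `m < 0`, `(v-v⁻¹)⁻¹` for `m = 0`, and for `m ≥ 1` the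
expression `Σ_{k=1}^m ((v-v⁻¹)^{k-1}/k!) Σ_{m₁+⋯+m_k=m, m_j ≥ 1} H_{μ,m₁}⋯H_{μ,m_k}`. -/
def gTheta (μ : I) (m : ℤ) : FA I :=
  if m < 0 then 0
  else if m = 0 then (vv - vv⁻¹)⁻¹ • (1 : FA I)
  else ∑ k ∈ Finset.Icc 1 m.toNat,
    ((vv - vv⁻¹) ^ (k - 1) / (Nat.factorial k : Kv)) •
      ∑ c ∈ (Finset.Nat.antidiagonalTuple k m.toNat).filter (fun c => ∀ i, 0 < c i),
        (List.ofFn fun i : Fin k => gH μ (c i)).prod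

/-- `[a,b]_u = ab - u·ba`. -/
def brk (a b : FA I) (u : Kv) : FA I := a * b - u • (b * a)

/-- `S(k₁,k₂|l;μ,ν)`. -/
def Sterm (μ ν : I) (k1 k2 l : ℤ) : FA I :=
  gB μ k1 * gB μ k2 * gB ν l - qint 2 • (gB μ k1 * gB ν l * gB μ k2) +
    gB ν l * gB μ k1 * gB μ k2

/-- `𝕊(k₁,k₂|l;μ,ν)`: symmetrization of `S` in `k₁,k₂` (no doubling when `k₁ = k₂`). -/
def Ssym (μ ν : I) (k1 k2 l : ℤ) : FA I :=
  if k1 = k2 then Sterm μ ν k1 k2 l else Sterm μ ν k1 k2 l + Sterm μ ν k2 k1 l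

/-- `R(k₁,k₂|l;μ,ν)`.  The sums over `p ≥ 0` (resp. `p ≥ 1`) are finite since
`Θ_{μ,m} = 0` for `m < 0`; the chosen ranges contain all indices giving a nonzero term. -/
def Rterm (μ ν : I) (k1 k2 l : ℤ) : FA I :=
  gK μ * gCpow k1 *
    (-(∑ p ∈ Finset.range ((k2 - k1).toNat + 1),
        (vv ^ (2 * p) * qint 2) •
          (brk (gTheta μ (k2 - k1 - 2 * p - 1)) (gB ν (l - 1)) (vv ^ (-2 : ℤ)) *
            gC ^ (p + 1)))
      - (∑ p ∈ Finset.Icc 1 (k2 - k1).toNat,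
          (vv ^ (2 * p - 1) * qint 2) •
            (brk (gB ν l) (gTheta μ (k2 - k1 - 2 * p)) (vv ^ (-2 : ℤ)) * gC ^ p))
      - brk (gB ν l) (gTheta μ (k2 - k1)) (vv ^ (-2 : ℤ)))

/-- `ℝ(k₁,k₂|l;μ,ν)`: symmetrization of `R` in `k₁,k₂` (no doubling when `k₁ = k₂`). -/
def Rsym (μ ν : I) (k1 k2 l : ℤ) : FA I :=
  if k1 = k2 then Rterm μ ν k1 k2 l else Rterm μ ν k1 k2 l + Rterm μ ν k2 k1 l

/-- The defining relations of the universal ıquantum loop algebra attached to a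
simply-laced GCM `c`. -/
inductive IQLArel (c : I → I → ℤ) : FA I → FA I → Prop
  | KKinv (μ : I) : IQLArel c (gK μ * gKinv μ) 1
  | KinvK (μ : I) : IQLArel c (gKinv μ * gK μ) 1
  | CCinv : IQLArel c (gC * gCinv) 1
  | CinvC : IQLArel c (gCinv * gC) 1
  | Kcentral (μ : I) (x : FA I) : IQLArel c (gK μ * x) (x * gK μ)
  | Kinvcentral (μ : I) (x : FA I) : IQLArel c (gKinv μ * x) (x * gKinv μ)
  | Ccentral (x : FA I) : IQLArel c (gC * x) (x * gC)
  | Cinvcentral (x : FA I) : IQLArel c (gCinv * x) (x * gCinv)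
  | HH (μ ν : I) (m n : ℕ) (hm : 1 ≤ m) (hn : 1 ≤ n) :
      IQLArel c (gH μ m * gH ν n) (gH ν n * gH μ m)
  | HB (μ ν : I) (m : ℕ) (hm : 1 ≤ m) (l : ℤ) :
      IQLArel c (gH μ m * gB ν l - gB ν l * gH μ m)
        ((qint (m * c μ ν) / (m : Kv)) • gB ν (l + m) -
          (qint (m * c μ ν) / (m : Kv)) • (gB ν (l - m) * gC ^ m))
  | BBzero (μ ν : I) (h : c μ ν = 0) (k l : ℤ) :
      IQLArel c (gB μ k * gB ν l) (gB ν l * gB μ k)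
  | BBne (μ ν : I) (h : μ ≠ ν) (k l : ℤ) :
      IQLArel c
        (brk (gB μ k) (gB ν (l + 1)) (vv ^ (-c μ ν)) -
          vv ^ (-c μ ν) • brk (gB μ (k + 1)) (gB ν l) (vv ^ (c μ ν))) 0
  | BBsame (μ : I) (k l : ℤ) :
      IQLArel c
        (brk (gB μ k) (gB μ (l + 1)) (vv ^ (-2 : ℤ)) -
          vv ^ (-2 : ℤ) • brk (gB μ (k + 1)) (gB μ l) (vv ^ (2 : ℤ)))
        (vv ^ (-2 : ℤ) • (gTheta μ (l - k + 1) * gCpow k * gK μ) -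
          vv ^ (-4 : ℤ) • (gTheta μ (l - k - 1) * gCpow (k + 1) * gK μ) +
          vv ^ (-2 : ℤ) • (gTheta μ (k - l + 1) * gCpow l * gK μ) -
          vv ^ (-4 : ℤ) • (gTheta μ (k - l - 1) * gCpow (l + 1) * gK μ))
  | serre (μ ν : I) (h : c μ ν = -1) (k1 k2 l : ℤ) :
      IQLArel c (Ssym μ ν k1 k2 l) (Rsym μ ν k1 k2 l)

/-- The universal ıquantum loop algebra `ĩU^Dr` attached to the GCM `c`. -/
abbrev UiDr (c : I → I → ℤ) : Type := RingQuot (IQLArel c)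

/-- The canonical projection from the free algebra to `ĩU^Dr`. -/
def toUiDr (c : I → I → ℤ) : FA I →ₐ[Kv] UiDr c := RingQuot.mkAlgHom Kv (IQLArel c)

/-- Vertices of the star-shaped graph `T_{p₁,…,p_t}`: the star point `none = ⋆` and the
branch vertices `some ⟨i,j⟩ = [i, j+1]` for `1 ≤ i ≤ t`, `1 ≤ j+1 ≤ p_i - 1`. -/
abbrev StarVertex (t : ℕ) (p : Fin t → ℕ) : Type := Option ((i : Fin t) × Fin (p i - 1))

/-- The simply-laced generalized Cartan matrix of the star-shaped graph
`T_{p₁,…,p_t}`: `c_{μν} = -1` for adjacent vertices, `0` for non-adjacent distinct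
vertices and `2` on the diagonal. -/
def starCartan (t : ℕ) (p : Fin t → ℕ) : StarVertex t p → StarVertex t p → ℤ
  | none, none => 2
  | none, some ⟨_, j⟩ => if (j : ℕ) = 0 then -1 else 0
  | some ⟨_, j⟩, none => if (j : ℕ) = 0 then -1 else 0
  | some ⟨i, j⟩, some ⟨i', j'⟩ =>
      if i.val = i'.val then
        if (j : ℕ) = (j' : ℕ) then 2
        else if (j : ℕ) + 1 = (j' : ℕ) ∨ (j' : ℕ) + 1 = (j : ℕ) then -1 else 0
      else 0


lemma vv_ne_zero : vv ≠ 0 := RatFunc.X_ne_zero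

lemma vv_pow_four_ne_one : vv ^ 4 ≠ 1 := by
  intro h
  have h' : (Polynomial.X ^ 4 : Polynomial ℚ) = 1 := by
    apply RatFunc.algebraMap_injective ℚ
    simpa [vv, RatFunc.algebraMap_X] using h
  simpa using congrArg Polynomial.natDegree h'

lemma vv_sub_inv_ne_zero : vv - vv⁻¹ ≠ 0 := by
  intro h
  have h0 := vv_ne_zero
  apply vv_pow_four_ne_one
  field_simp at h
  linear_combination (vv ^ 2 + 1) * h

lemma qint_two : qint 2 = vv + vv⁻¹ := by
  have h0 := vv_ne_zero
  rw [qint, div_eq_iff vv_sub_inv_ne_zero, zpow_neg]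
  norm_cast
  field_simp
  ring

lemma qint_two_ne_zero : qint 2 ≠ 0 := by
  rw [qint_two]
  intro h
  have h0 := vv_ne_zero
  apply vv_pow_four_ne_one
  field_simp at h
  linear_combination (vv ^ 2 - 1) * h

lemma Subalgebra.smul_mem_iff_of_ne_zero {k A : Type*} [Field k] [Ring A] [Algebra k A]
    (S : Subalgebra k A) {r : k} (hr : r ≠ 0) {x : A} : r • x ∈ S ↔ x ∈ S :=
  Submodule.smul_mem_iff (Subalgebra.toSubmodule S) hr

/-- `Θ_{μ,m}` is `H_{μ,m}` up to products of `H_{μ,j}` with `j < m`. -/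
lemma gTheta_sub_gH_mem (T : Subalgebra Kv (FA I)) (μ : I) (m : ℕ) (hm : 1 ≤ m)
    (hT : ∀ j, 1 ≤ j → j < m → gH μ j ∈ T) : gTheta μ m - gH μ m ∈ T := by
  have hsplit : Finset.Icc 1 m = insert 1 (Finset.Icc 2 m) := by
    ext k; simp only [Finset.mem_Icc, Finset.mem_insert]; omega
  have hfil : (Finset.Nat.antidiagonalTuple 1 m).filter (fun c => ∀ i, 0 < c i) = {![m]} := by
    rw [Finset.Nat.antidiagonalTuple_one, Finset.filter_singleton, if_pos]
    intro i
    fin_cases i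
    exact hm
  rw [gTheta, if_neg (by omega), if_neg (by omega), Int.toNat_natCast, hsplit,
    Finset.sum_insert (by simp), hfil]
  simp only [tsub_self, pow_zero, Nat.factorial_one, Nat.cast_one, div_one, one_smul,
    Finset.sum_singleton, List.ofFn_succ, List.ofFn_zero, List.prod_cons, List.prod_nil, mul_one,
    Matrix.cons_val_zero, add_sub_cancel_left]
  refine T.sum_mem fun k hk => T.smul_mem (T.sum_mem fun c hc => T.list_prod_mem ?_) _
  simp only [Finset.mem_Icc] at hk
  rw [Finset.mem_filter, Finset.Nat.mem_antidiagonalTuple] at hc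
  intro x hx
  obtain ⟨i, rfl⟩ := (List.mem_ofFn' _ _).1 hx
  refine hT _ (hc.2 i) ?_
  have : Nontrivial (Fin k) := Fin.nontrivial_iff_two_le.2 hk.1
  obtain ⟨j, hj⟩ := exists_ne i
  have := Finset.add_le_sum (f := c) (s := Finset.univ) (fun _ _ => Nat.zero_le _)
    (Finset.mem_univ i) (Finset.mem_univ j) hj.symm
  have := hc.2 j
  omega

section Quotient

variable {c : I → I → ℤ}

lemma toUiDr_eq {x y : FA I} (h : IQLArel c x y) : toUiDr c x = toUiDr c y :=
  RingQuot.mkAlgHom_rel Kv h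

lemma toUiDr_gCpow_mem {S : Subalgebra Kv (UiDr c)} (hC : toUiDr c gC ∈ S)
    (hC' : toUiDr c gCinv ∈ S) (k : ℤ) : toUiDr c (gCpow k) ∈ S := by
  unfold gCpow
  split_ifs
  · rw [map_pow]; exact S.pow_mem hC _
  · rw [map_pow]; exact S.pow_mem hC' _

lemma toUiDr_gCpow_mul_gCpow_neg (k : ℤ) :
    toUiDr c (gCpow k) * toUiDr c (gCpow (-k)) = 1 := by
  have h1 : toUiDr c gC * toUiDr c gCinv = 1 := by
    rw [← map_mul, toUiDr_eq .CCinv, map_one]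
  have h2 : toUiDr c gCinv * toUiDr c gC = 1 := by
    rw [← map_mul, toUiDr_eq .CinvC, map_one]
  have hcomm : Commute (toUiDr c gC) (toUiDr c gCinv) := h1.trans h2.symm
  rcases lt_trichotomy k 0 with hk | rfl | hk
  · rw [gCpow, gCpow, if_neg (by omega), if_pos (by omega), map_pow, map_pow,
      ← hcomm.symm.mul_pow, h2, one_pow]
  · simp [gCpow]
  · rw [gCpow, gCpow, if_pos (by omega), if_neg (by omega), map_pow, map_pow, neg_neg,
      ← hcomm.mul_pow, h1, one_pow]

/-- A subalgebra of the ıquantum loop algebra containing the Cartan elements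
`K_μ^{±1}` and `C^{±1}`. -/
structure ContainsCartan (S : Subalgebra Kv (UiDr c)) : Prop where
  K_mem (μ : I) : toUiDr c (gK μ) ∈ S
  Kinv_mem (μ : I) : toUiDr c (gKinv μ) ∈ S
  C_mem : toUiDr c gC ∈ S
  Cinv_mem : toUiDr c gCinv ∈ S

namespace ContainsCartan

variable {S : Subalgebra Kv (UiDr c)}

lemma Cpow_mem (hS : ContainsCartan S) (k : ℤ) : toUiDr c (gCpow k) ∈ S :=
  toUiDr_gCpow_mem hS.C_mem hS.Cinv_mem k

lemma mem_of_mul_K_mem (hS : ContainsCartan S) {x : UiDr c} (μ : I)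
    (h : x * toUiDr c (gK μ) ∈ S) : x ∈ S := by
  have := S.mul_mem h (hS.Kinv_mem μ)
  rwa [mul_assoc, ← map_mul, toUiDr_eq (.KKinv μ), map_one, mul_one] at this

lemma mem_of_K_mul_mem (hS : ContainsCartan S) {x : UiDr c} (μ : I)
    (h : toUiDr c (gK μ) * x ∈ S) : x ∈ S := by
  have := S.mul_mem (hS.Kinv_mem μ) h
  rwa [← mul_assoc, ← map_mul, toUiDr_eq (.KinvK μ), map_one, one_mul] at this

lemma mem_of_mul_Cpow_mem (hS : ContainsCartan S) {x : UiDr c} (k : ℤ)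
    (h : x * toUiDr c (gCpow k) ∈ S) : x ∈ S := by
  have := S.mul_mem h (hS.Cpow_mem (-k))
  rwa [mul_assoc, toUiDr_gCpow_mul_gCpow_neg, mul_one] at this

lemma mem_of_Cpow_mul_mem (hS : ContainsCartan S) {x : UiDr c} (k : ℤ)
    (h : toUiDr c (gCpow k) * x ∈ S) : x ∈ S := by
  have := S.mul_mem (hS.Cpow_mem (-k)) h
  have h1 := toUiDr_gCpow_mul_gCpow_neg (c := c) (-k)
  rw [neg_neg] at h1
  rwa [← mul_assoc, h1, one_mul] at this

lemma mem_of_mul_C_mem (hS : ContainsCartan S) {x : UiDr c}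
    (h : x * toUiDr c gC ∈ S) : x ∈ S := by
  refine hS.mem_of_mul_Cpow_mem 1 ?_
  simpa [gCpow] using h

lemma toUiDr_brk_mem {x y : FA I} (hx : toUiDr c x ∈ S) (hy : toUiDr c y ∈ S) (u : Kv) :
    toUiDr c (brk x y u) ∈ S := by
  rw [brk, map_sub, map_smul, map_mul, map_mul]
  exact S.sub_mem (S.mul_mem hx hy) (S.smul_mem (S.mul_mem hy hx) _)

lemma gTheta_one_mem (hS : ContainsCartan S) {μ : I} {a : ℤ} (h0 : toUiDr c (gB μ a) ∈ S)
    (h1 : toUiDr c (gB μ (a + 1)) ∈ S) : toUiDr c (gTheta μ 1) ∈ S := by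
  have hrel := toUiDr_eq (IQLArel.BBsame (c := c) μ a a)
  have hl : toUiDr c (brk (gB μ a) (gB μ (a + 1)) (vv ^ (-2 : ℤ)) -
      vv ^ (-2 : ℤ) • brk (gB μ (a + 1)) (gB μ a) (vv ^ (2 : ℤ))) ∈ S := by
    rw [map_sub, map_smul]
    exact S.sub_mem (toUiDr_brk_mem h0 h1 _) (S.smul_mem (toUiDr_brk_mem h1 h0 _) _)
  have hneg : gTheta μ (-1) = 0 := by simp [gTheta]
  rw [hrel] at hl
  simp only [sub_self, zero_add, zero_sub, hneg, zero_mul, smul_zero, sub_zero, ← two_smul Kv,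
    smul_smul, map_smul] at hl
  rw [S.smul_mem_iff_of_ne_zero (mul_ne_zero two_ne_zero (zpow_ne_zero _ vv_ne_zero)),
    map_mul, map_mul] at hl
  exact hS.mem_of_mul_Cpow_mem a (hS.mem_of_mul_K_mem μ hl)

lemma gB_mem (hS : ContainsCartan S) {μ : I} (hμ : c μ μ = 2) {a : ℤ}
    (h0 : toUiDr c (gB μ a) ∈ S) (h1 : toUiDr c (gB μ (a + 1)) ∈ S) (l : ℤ) :
    toUiDr c (gB μ l) ∈ S := by
  have hH : toUiDr c (gH μ 1) ∈ S := by
    have hd := gTheta_sub_gH_mem (S.comap (toUiDr c)) μ 1 le_rfl (by omega)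
    have := S.sub_mem (hS.gTheta_one_mem h0 h1) hd
    simpa using this
  have key (l : ℤ) (hl : toUiDr c (gB μ l) ∈ S) :
      toUiDr c (gB μ (l + 1)) - toUiDr c (gB μ (l - 1)) * toUiDr c gC ∈ S := by
    have hrel := toUiDr_eq (IQLArel.HB (c := c) μ μ 1 le_rfl l)
    have hm : toUiDr c (gH μ 1 * gB μ l - gB μ l * gH μ 1) ∈ S := by
      rw [map_sub, map_mul, map_mul]
      exact S.sub_mem (S.mul_mem hH hl) (S.mul_mem hl hH)
    rw [hrel, ← smul_sub, map_smul] at hm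
    simp only [hμ, Nat.cast_one, one_mul, div_one, pow_one] at hm
    rwa [S.smul_mem_iff_of_ne_zero qint_two_ne_zero, map_sub, map_mul] at hm
  have hpair (l : ℤ) : toUiDr c (gB μ l) ∈ S ∧ toUiDr c (gB μ (l + 1)) ∈ S := by
    induction l using Int.inductionOn' (b := a) with
    | zero => exact ⟨h0, h1⟩
    | succ k _ ih =>
      refine ⟨ih.2, ?_⟩
      have := S.add_mem (key _ ih.2) (S.mul_mem (by simpa using ih.1) hS.C_mem)
      simpa using this
    | pred k _ ih =>
      refine ⟨hS.mem_of_mul_C_mem ?_, by simpa using ih.1⟩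
      simpa using S.sub_mem ih.2 (key _ ih.1)
  exact (hpair l).1

lemma gTheta_mem (hS : ContainsCartan S) {μ : I} (hB : ∀ l, toUiDr c (gB μ l) ∈ S) (n : ℕ) :
    toUiDr c (gTheta μ n) ∈ S := by
  induction n using Nat.strong_induction_on with
  | _ n ih =>
  rcases Nat.lt_or_ge n 2 with hn | hn
  · interval_cases n
    · simp only [gTheta, Nat.cast_zero, lt_self_iff_false, if_false, if_true, map_smul, map_one]
      exact S.smul_mem S.one_mem _
    · exact_mod_cast hS.gTheta_one_mem (hB 0) (hB _)
  obtain ⟨m, rfl⟩ := Nat.exists_eq_add_of_le' hn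
  have hrel := toUiDr_eq (IQLArel.BBsame (c := c) μ 0 (m + 1))
  have hl : toUiDr c (brk (gB μ 0) (gB μ (m + 1 + 1)) (vv ^ (-2 : ℤ)) -
      vv ^ (-2 : ℤ) • brk (gB μ (0 + 1)) (gB μ (m + 1)) (vv ^ (2 : ℤ))) ∈ S := by
    rw [map_sub, map_smul]
    exact S.sub_mem (toUiDr_brk_mem (hB _) (hB _) _)
      (S.smul_mem (toUiDr_brk_mem (hB _) (hB _) _) _)
  have hle (j : ℤ) (hj : j ≤ m) : toUiDr c (gTheta μ j) ∈ S := by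
    rcases lt_or_ge j 0 with h | h
    · simp [gTheta, h]
    · lift j to ℕ using h
      exact ih j (by omega)
  have hmul (j k : ℤ) (u : Kv) (hj : j ≤ m) :
      u • (toUiDr c (gTheta μ j) * toUiDr c (gCpow k) * toUiDr c (gK μ)) ∈ S :=
    S.smul_mem (S.mul_mem (S.mul_mem (hle j hj) (hS.Cpow_mem k)) (hS.K_mem μ)) u
  rw [hrel] at hl
  simp only [map_add, map_sub, map_smul, map_mul] at hl
  rw [sub_eq_add_neg, add_mem_cancel_right (S.neg_mem (hmul _ _ _ (by omega))),
    add_mem_cancel_right (hmul _ _ _ (by omega)), sub_eq_add_neg,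
    add_mem_cancel_right (S.neg_mem (hmul _ _ _ (by omega))),
    S.smul_mem_iff_of_ne_zero (zpow_ne_zero _ vv_ne_zero)] at hl
  have := hS.mem_of_mul_Cpow_mem _ (hS.mem_of_mul_K_mem μ hl)
  have he : ((m : ℤ) + 1 - 0 + 1) = ((m + 2 : ℕ) : ℤ) := by push_cast; ring
  rwa [he] at this

lemma gH_mem (hS : ContainsCartan S) {μ : I} (hB : ∀ l, toUiDr c (gB μ l) ∈ S) (m : ℕ)
    (hm : 1 ≤ m) : toUiDr c (gH μ m) ∈ S := by
  induction m using Nat.strong_induction_on with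
  | _ m ih =>
  have hd := gTheta_sub_gH_mem (S.comap (toUiDr c)) μ m hm fun j h1 h2 => ih j h2 h1
  simpa using S.sub_mem (hS.gTheta_mem hB m) hd

/-- The Serre relation at `k₁ = k₂` recovers `B_{ν,l}` from a double commutator with `B_{μ,k}`. -/
lemma gB_mem_of_Sterm_mem (hS : ContainsCartan S) {μ ν : I} (h : c μ ν = -1) {k l : ℤ}
    (hm : toUiDr c (Sterm μ ν k k l) ∈ S) : toUiDr c (gB ν l) ∈ S := by
  have hrel := toUiDr_eq (IQLArel.serre (c := c) μ ν h k k l)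
  have hR : Rterm μ ν k k l =
      (-(1 - vv ^ (-2 : ℤ)) * (vv - vv⁻¹)⁻¹) • (gK μ * (gCpow k * gB ν l)) := by
    have hneg : gTheta μ (-1) = 0 := by simp [gTheta]
    have hzero : gTheta μ 0 = (vv - vv⁻¹)⁻¹ • (1 : FA I) := by simp [gTheta]
    simp only [Rterm, brk, sub_self, Int.toNat_zero, zero_add, Finset.sum_range_one,
      Nat.cast_zero, mul_zero, zero_sub, hneg, hzero, zero_mul, smul_zero, neg_zero,
      Finset.Icc_eq_empty_of_lt Nat.zero_lt_one, Finset.sum_empty, mul_smul_comm, smul_mul_assoc,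
      mul_one, one_mul, mul_neg, mul_sub, mul_assoc]
    rw [neg_mul, neg_smul, sub_mul, sub_smul, one_mul, mul_smul]
  rw [Ssym, Rsym, if_pos rfl, if_pos rfl, hR, map_smul, map_mul, map_mul] at hrel
  rw [hrel, S.smul_mem_iff_of_ne_zero] at hm
  · exact hS.mem_of_Cpow_mul_mem k (hS.mem_of_K_mul_mem μ hm)
  · refine mul_ne_zero (neg_ne_zero.2 fun h0 => vv_sub_inv_ne_zero ?_)
      (inv_ne_zero vv_sub_inv_ne_zero)
    have hv := vv_ne_zero
    have : vv - vv⁻¹ = vv * (1 - vv ^ (-2 : ℤ)) := by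
      rw [zpow_neg]; norm_cast; field_simp
    rw [this, h0, mul_zero]

lemma Sterm_eq_brk (μ ν : I) (k l : ℤ) {u w : Kv} (huw : u * w = 1) (hq : u + w = qint 2) :
    Sterm μ ν k k l = brk (gB μ k) (brk (gB μ k) (gB ν l) u) w := by
  simp only [Sterm, brk, ← hq, mul_sub, sub_mul, mul_smul_comm, smul_mul_assoc, smul_sub,
    smul_smul, mul_comm w u, huw, mul_assoc, add_smul, one_smul]
  abel

lemma gB_succ_mem (hS : ContainsCartan S) {μ ν : I} (hne : μ ≠ ν) (h : c μ ν = -1)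
    (hB : ∀ k, toUiDr c (gB μ k) ∈ S) {l : ℤ} (hl : toUiDr c (gB ν l) ∈ S) :
    toUiDr c (gB ν (l + 1)) ∈ S := by
  refine hS.gB_mem_of_Sterm_mem h (k := 0) ?_
  rw [Sterm_eq_brk μ ν 0 (l + 1) (mul_inv_cancel₀ vv_ne_zero) qint_two.symm]
  refine toUiDr_brk_mem (hB _) ?_ _
  have hrel := toUiDr_eq (IQLArel.BBne (c := c) μ ν hne 0 l)
  rw [map_sub, map_zero, sub_eq_zero, h, neg_neg, zpow_one, map_smul] at hrel
  rw [hrel]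
  exact S.smul_mem (toUiDr_brk_mem (hB _) hl _) _

lemma gB_pred_mem (hS : ContainsCartan S) {μ ν : I} (hne : μ ≠ ν) (h : c μ ν = -1)
    (hB : ∀ k, toUiDr c (gB μ k) ∈ S) {l : ℤ} (hl : toUiDr c (gB ν l) ∈ S) :
    toUiDr c (gB ν (l - 1)) ∈ S := by
  refine hS.gB_mem_of_Sterm_mem h (k := 0 + 1) ?_
  rw [Sterm_eq_brk μ ν _ (l - 1) (inv_mul_cancel₀ vv_ne_zero)
    ((add_comm _ _).trans qint_two.symm)]
  refine toUiDr_brk_mem (hB _) ?_ _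
  have hrel := toUiDr_eq (IQLArel.BBne (c := c) μ ν hne 0 (l - 1))
  rw [map_sub, map_zero, sub_eq_zero, h, neg_neg, zpow_one, map_smul, sub_add_cancel,
    zpow_neg_one] at hrel
  rw [← S.smul_mem_iff_of_ne_zero vv_ne_zero, ← hrel]
  exact toUiDr_brk_mem (hB _) hl _

/-- Membership of all `B_{μ,k}` propagates along an edge `μ — ν` from a single `B_{ν,0}`. -/
lemma gB_mem_of_adj (hS : ContainsCartan S) {μ ν : I} (hne : μ ≠ ν) (h : c μ ν = -1)
    (hB : ∀ k, toUiDr c (gB μ k) ∈ S) (h0 : toUiDr c (gB ν 0) ∈ S) (l : ℤ) :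
    toUiDr c (gB ν l) ∈ S := by
  induction l with
  | zero => exact h0
  | succ k ih => exact hS.gB_succ_mem hne h hB ih
  | pred k ih => exact hS.gB_pred_mem hne h hB ih

lemma eq_top (hS : ContainsCartan S) (hB : ∀ μ l, toUiDr c (gB μ l) ∈ S) : S = ⊤ := by
  have hcomap : S.comap (toUiDr c) = ⊤ := by
    rw [eq_top_iff, ← FreeAlgebra.adjoin_range_ι, Algebra.adjoin_le_iff]
    rintro _ ⟨g, rfl⟩
    cases g with
    | K μ => exact hS.K_mem μ
    | Kinv μ => exact hS.Kinv_mem μ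
    | C => exact hS.C_mem
    | Cinv => exact hS.Cinv_mem
    | H μ n => exact hS.gH_mem (hB μ) (n + 1) (Nat.le_add_left _ _)
    | B μ l => exact hB μ l
  rw [Algebra.eq_top_iff]
  intro x
  obtain ⟨y, rfl⟩ := RingQuot.mkAlgHom_surjective Kv (IQLArel c) x
  have hy : y ∈ S.comap (toUiDr c) := hcomap ▸ Algebra.mem_top
  exact hy

end ContainsCartan

end Quotient

/-- A subalgebra for a star-shaped graph containing the reduced generators is everything. -/
lemma starCartan_eq_top {t : ℕ} {p : Fin t → ℕ} {S : Subalgebra Kv (UiDr (starCartan t p))}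
    (hS : ContainsCartan S) {a : ℤ} (ha : toUiDr (starCartan t p) (gB none a) ∈ S)
    (ha' : toUiDr (starCartan t p) (gB none (a + 1)) ∈ S)
    (hzero : ∀ μ : StarVertex t p, μ ≠ none → toUiDr (starCartan t p) (gB μ 0) ∈ S) :
    S = ⊤ := by
  have hstar (l : ℤ) : toUiDr (starCartan t p) (gB none l) ∈ S := hS.gB_mem rfl ha ha' l
  have hbranch (i : Fin t) (j : ℕ) (hj : j < p i - 1) (l : ℤ) :
      toUiDr (starCartan t p) (gB (some ⟨i, ⟨j, hj⟩⟩) l) ∈ S := by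
    induction j generalizing l with
    | zero =>
      exact hS.gB_mem_of_adj (Option.some_ne_none _).symm (by simp [starCartan]) hstar
        (hzero _ (Option.some_ne_none _)) l
    | succ j ih =>
      exact hS.gB_mem_of_adj (μ := some ⟨i, ⟨j, by omega⟩⟩) (by simp) (by simp [starCartan])
        (ih (by omega)) (hzero _ (Option.some_ne_none _)) l
  refine hS.eq_top fun μ l => ?_
  match μ with
  | none => exact hstar l
  | some ⟨i, ⟨j, hj⟩⟩ => exact hbranch i j hj l

/-- Lemma 2.7 (star-shaped graphs): for any `a ∈ ℤ`, the universal ıquantum loop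
algebra `ĩU^Dr` of the star-shaped graph `T_{p₁,…,p_t}` is generated as a
`ℚ(v)`-algebra by `B_{⋆,a}`, `B_{⋆,a+1}`, `B_{μ,0}` for `μ ∈ 𝕀 ∖ {⋆}`,
`K_μ^{±1}` for `μ ∈ 𝕀`, and `C^{±1}`. -/
theorem UiDr_reduced_generators (t : ℕ) (ht : 1 ≤ t) (p : Fin t → ℕ)
    (hp : ∀ i, 1 ≤ p i) (a : ℤ) :
    Algebra.adjoin Kv
      {x : UiDr (starCartan t p) |
        x = toUiDr (starCartan t p) (gB none a) ∨
        x = toUiDr (starCartan t p) (gB none (a + 1)) ∨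
        (∃ μ : StarVertex t p, μ ≠ none ∧ x = toUiDr (starCartan t p) (gB μ 0)) ∨
        (∃ μ : StarVertex t p, x = toUiDr (starCartan t p) (gK μ)) ∨
        (∃ μ : StarVertex t p, x = toUiDr (starCartan t p) (gKinv μ)) ∨
        x = toUiDr (starCartan t p) gC ∨
        x = toUiDr (starCartan t p) gCinv} = ⊤ := by
  refine starCartan_eq_top (a := a)
    ⟨fun μ => Algebra.subset_adjoin (Or.inr (Or.inr (Or.inr (Or.inl ⟨μ, rfl⟩)))),
      fun μ => Algebra.subset_adjoin (Or.inr (Or.inr (Or.inr (Or.inr (Or.inl ⟨μ, rfl⟩))))),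
      Algebra.subset_adjoin ?_, Algebra.subset_adjoin ?_⟩
    (Algebra.subset_adjoin ?_) (Algebra.subset_adjoin ?_)
    fun μ hμ => Algebra.subset_adjoin (Or.inr (Or.inr (Or.inl ⟨μ, hμ, rfl⟩)))
  all_goals simp

end
end

section
/- Let n ≥ 2, let a ≥ 1 be an integer, and let M be a nilpotent representation of C_n over F_q satisfying Hom(M, S_j) = 0 = Ext^1(M, S_j) for all 2 ≤ j ≤ n−1. Then Σ_{[N] : ℓ(N) = ℓ(M)+1} |Ext^1(M, S_0^{(an−1)})_N| = |Hom(M, S_0^{(an−1)})| / |Hom(M, S_0^{(n−1)})|, where the sum runs over isomorphism classes [N] of nilpotent representations of C_n with ℓ(N) = ℓ(M)+1 (only finitely many terms are nonzero). -/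
open DirectSum

noncomputable section

/-- A finite-dimensional representation of the cyclic quiver `C_n` over a field `F`:
finite-dimensional `F`-vector spaces `V j` for `j : ZMod n` and linear maps
`x j : V j → V (j - 1)` (one arrow `j → j - 1` for each vertex). -/
structure CRep (F : Type) [Field F] (n : ℕ) : Type 1 where
  V : ZMod n → Type
  [acg : ∀ j, AddCommGroup (V j)]
  [mod : ∀ j, Module F (V j)]
  [fin : ∀ j, Module.Finite F (V j)]
  x : ∀ j : ZMod n, V j →ₗ[F] V (j - 1)

attribute [instance] CRep.acg CRep.mod CRep.fin

namespace CRep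

variable {F : Type} [Field F] {n : ℕ}

/-- Morphisms of representations of `C_n`. -/
structure Hom (M N : CRep F n) : Type where
  f : ∀ j, M.V j →ₗ[F] N.V j
  comm : ∀ j, (f (j - 1)).comp (M.x j) = (N.x j).comp (f j)

/-- The endomorphism of the total space `⨁ j, V j` induced by the maps `x j`. -/
def total (M : CRep F n) : Module.End F (⨁ j, M.V j) :=
  DirectSum.toModule F (ZMod n) (⨁ j, M.V j)
    (fun j => (DirectSum.lof F (ZMod n) M.V (j - 1)).comp (M.x j))

/-- A representation is nilpotent if the composite of its structure maps around the
cycle is nilpotent, i.e. the induced endomorphism of `⨁ j, V j` is nilpotent. -/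
def IsNilpotentRep (M : CRep F n) : Prop := IsNilpotent M.total

/-- Isomorphism of representations. -/
def Iso (M N : CRep F n) : Prop := ∃ φ : Hom M N, ∀ j, Function.Bijective (φ.f j)

/-- The zero representations. -/
def IsZero (M : CRep F n) : Prop := ∀ j, Subsingleton (M.V j)

/-- Direct sum of two representations. -/
def prod (M N : CRep F n) : CRep F n where
  V j := M.V j × N.V j
  x j := (M.x j).prodMap (N.x j)

/-- Finite direct sums of representations. -/
def pi {ι : Type} [Fintype ι] (W : ι → CRep F n) : CRep F n where
  V j := ∀ i, (W i).V j
  x j := LinearMap.pi fun i =>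
    ((W i).x j).comp (LinearMap.proj (R := F) (φ := fun i' => (W i').V j) i)

/-- Indecomposability. -/
def Indecomp (M : CRep F n) : Prop :=
  ¬ M.IsZero ∧ ∀ A B : CRep F n, M.Iso (A.prod B) → A.IsZero ∨ B.IsZero

/-- `M` decomposes into exactly `k` indecomposable direct summands, i.e. `ℓ(M) = k`
(this is well defined by the Krull–Schmidt theorem). -/
def hasLen (M : CRep F n) (k : ℕ) : Prop :=
  ∃ W : Fin k → CRep F n, (∀ i, Indecomp (W i)) ∧ M.Iso (pi W)

/-- Total dimension (= length, since all composition factors are 1-dimensional). -/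
def totalDim [NeZero n] (M : CRep F n) : ℕ := ∑ j : ZMod n, Module.finrank F (M.V j)

/-- `X ≅ S_j^{(a)}`, the unique indecomposable nilpotent representation of length `a`
with top `S_j` (interpreted as the zero representation for `a = 0`): `X` is nilpotent,
indecomposable, of length `a`, and its top is concentrated at `j`, i.e. the structure
map into the vertex `j` is not surjective. -/
def IsSja [NeZero n] (j : ZMod n) (a : ℕ) (X : CRep F n) : Prop :=
  if a = 0 then X.IsZero
  else X.IsNilpotentRep ∧ X.Indecomp ∧ X.totalDim = a ∧
    ¬ Function.Surjective (X.x (j + 1))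

/-- `|Hom(M,N)|`. -/
def homCount (M N : CRep F n) : ℕ := Nat.card (Hom M N)

/-- `|Aut(M)|`. -/
def autCount (M : CRep F n) : ℕ :=
  Nat.card {φ : Hom M M // ∀ j, Function.Bijective (φ.f j)}

/-- Short exact sequences `0 → N → E → M → 0` of representations. -/
structure SES (N M : CRep F n) : Type 1 where
  E : CRep F n
  i : Hom N E
  p : Hom E M
  inj : ∀ j, Function.Injective (i.f j)
  surj : ∀ j, Function.Surjective (p.f j)
  exct : ∀ j, LinearMap.range (i.f j) = LinearMap.ker (p.f j)

/-- Baer equivalence of short exact sequences (a morphism of middle terms commuting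
with the identities of `N` and `M`; such a morphism is automatically an isomorphism). -/
def BaerEq {N M : CRep F n} (s s' : SES N M) : Prop :=
  ∃ φ : Hom s.E s'.E,
    (∀ j, (φ.f j).comp (s.i.f j) = s'.i.f j) ∧
    (∀ j, (s'.p.f j).comp (φ.f j) = s.p.f j)

/-- The number of Baer equivalence classes of extensions `0 → N → E → M → 0` whose
middle term `E` satisfies `P`.  For `P = fun _ => True` this is `|Ext¹(M,N)|`; for
`P = iso class of L` it is `|Ext¹(M,N)_L|`; for `P = fun E => hasLen E k` it is
`Σ_{[L] : ℓ(L) = k} |Ext¹(M,N)_L|`. -/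
def extCount (N M : CRep F n) (P : CRep F n → Prop) : ℕ :=
  Nat.card (Quot fun s s' : {s : SES N M // P s.E} => BaerEq s.1 s'.1)

/-- A short exact sequence splits. -/
def SES.Splits {N M : CRep F n} (s : SES N M) : Prop :=
  ∃ σ : Hom M s.E, ∀ j, (s.p.f j).comp (σ.f j) = LinearMap.id

end CRep

namespace CRep

variable {F : Type} [Field F] {n : ℕ}

/-! ### Isomorphisms and subrepresentations -/

lemma Hom.comm_apply {M N : CRep F n} (φ : Hom M N) (j : ZMod n) (v : M.V j) :
    φ.f (j - 1) (M.x j v) = N.x j (φ.f j v) :=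
  LinearMap.congr_fun (φ.comm j) v

lemma Iso.symm {M N : CRep F n} (h : M.Iso N) : N.Iso M := by
  obtain ⟨φ, hφ⟩ := h
  refine ⟨⟨fun j => (LinearEquiv.ofBijective (φ.f j) (hφ j)).symm.toLinearMap, fun j => ?_⟩,
    fun j => LinearEquiv.bijective _⟩
  ext w
  obtain ⟨v, rfl⟩ := (LinearEquiv.ofBijective (φ.f j) (hφ j)).surjective w
  simp only [LinearMap.comp_apply, LinearEquiv.coe_coe, LinearEquiv.symm_apply_apply]
  rw [LinearEquiv.symm_apply_eq, LinearEquiv.ofBijective_apply, LinearEquiv.ofBijective_apply,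
    φ.comm_apply]

lemma Iso.trans {M N P : CRep F n} (h : M.Iso N) (h' : N.Iso P) : M.Iso P := by
  obtain ⟨φ, hφ⟩ := h
  obtain ⟨ψ, hψ⟩ := h'
  refine ⟨⟨fun j => (ψ.f j).comp (φ.f j), fun j => ?_⟩, fun j => (hψ j).comp (hφ j)⟩
  ext v
  simp [φ.comm_apply, ψ.comm_apply]

/-- A family of subspaces stable under the structure maps, as a representation. -/
def sub (M : CRep F n) (U : ∀ j, Submodule F (M.V j))
    (hU : ∀ j, ∀ v ∈ U j, M.x j v ∈ U (j - 1)) : CRep F n where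
  V j := U j
  x j := (M.x j).restrict (hU j)

lemma iso_prod_sub (M : CRep F n) (U U' : ∀ j, Submodule F (M.V j))
    (hU : ∀ j, ∀ v ∈ U j, M.x j v ∈ U (j - 1)) (hU' : ∀ j, ∀ v ∈ U' j, M.x j v ∈ U' (j - 1))
    (h : ∀ j, IsCompl (U j) (U' j)) : M.Iso ((M.sub U hU).prod (M.sub U' hU')) := by
  refine Iso.symm ⟨⟨fun j => (Submodule.prodEquivOfIsCompl _ _ (h j)).toLinearMap, fun j => ?_⟩,
    fun j => LinearEquiv.bijective _⟩
  refine LinearMap.ext fun v => ?_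
  exact (map_add (M.x j) (show U j from v.1).1 (show U' j from v.2).1).symm

/-! ### Nilpotency -/

lemma total_lof (M : CRep F n) (j : ZMod n) (v : M.V j) :
    M.total (lof F (ZMod n) M.V j v) = lof F (ZMod n) M.V (j - 1) (M.x j v) := by
  simp [total, toModule_lof]

lemma Hom.lmap_total {M N : CRep F n} (φ : Hom M N) (w : ⨁ j, M.V j) :
    lmap φ.f (M.total w) = N.total (lmap φ.f w) := by
  suffices (lmap φ.f).comp M.total = N.total.comp (lmap φ.f) from LinearMap.congr_fun this w
  refine DirectSum.linearMap_ext F fun j => LinearMap.ext fun v => ?_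
  simp only [LinearMap.comp_apply]
  rw [total_lof, lmap_lof, lmap_lof, total_lof, φ.comm_apply]

lemma Hom.lmap_total_pow {M N : CRep F n} (φ : Hom M N) (t : ℕ) (w : ⨁ j, M.V j) :
    lmap φ.f ((M.total ^ t) w) = (N.total ^ t) (lmap φ.f w) := by
  induction t generalizing w with
  | zero => simp
  | succ t ih => rw [pow_succ, pow_succ, Module.End.mul_apply, ih, φ.lmap_total,
      Module.End.mul_apply]

lemma IsNilpotentRep.of_injective {M N : CRep F n} (hN : N.IsNilpotentRep) (φ : Hom M N)
    (hφ : ∀ j, Function.Injective (φ.f j)) : M.IsNilpotentRep := by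
  obtain ⟨t, ht⟩ := hN
  refine ⟨t, LinearMap.ext fun w => (lmap_injective φ.f).2 hφ ?_⟩
  rw [φ.lmap_total_pow, ht]
  simp

lemma SES.isNilpotentRep {M N : CRep F n} (s : SES N M) (hN : N.IsNilpotentRep)
    (hM : M.IsNilpotentRep) : s.E.IsNilpotentRep := by
  obtain ⟨a, ha⟩ := hN
  obtain ⟨b, hb⟩ := hM
  refine ⟨a + b, LinearMap.ext fun w => ?_⟩
  have h0 : lmap s.p.f ((s.E.total ^ b) w) = 0 := by
    rw [s.p.lmap_total_pow, hb]; rfl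
  obtain ⟨u, hu⟩ : ∃ u, lmap s.i.f u = (s.E.total ^ b) w := by
    suffices (s.E.total ^ b) w ∈ LinearMap.range (lmap s.i.f) from this
    generalize (s.E.total ^ b) w = z at h0
    have hz : ∀ j, z j ∈ LinearMap.range (s.i.f j) := fun j => by
      rw [s.exct, LinearMap.mem_ker, ← lmap_apply, h0]; rfl
    choose g hg using hz
    classical
    rw [← DirectSum.sum_support_of z]
    refine Submodule.sum_mem _ fun j _ => ⟨lof F _ _ j (g j), ?_⟩
    rw [lmap_lof, hg, lof_eq_of]
  rw [pow_add, Module.End.mul_apply, ← hu, ← s.i.lmap_total_pow, ha]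
  simp

lemma total_pow_lof (M : CRep F n) (t : ℕ) (j : ZMod n) (v : M.V j) :
    ∃ w, (M.total ^ t) (lof F (ZMod n) M.V j v) = lof F (ZMod n) M.V (j - t) w := by
  induction t with
  | zero => rw [Nat.cast_zero, sub_zero]; exact ⟨v, rfl⟩
  | succ t ih =>
    obtain ⟨w, hw⟩ := ih
    have : j - ((t + 1 : ℕ) : ZMod n) = j - t - 1 := by push_cast; ring
    rw [this, pow_succ', Module.End.mul_apply, hw]
    exact ⟨_, total_lof _ _ _⟩

/-- The projection of the total space onto its component at the vertex `i`. -/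
def proj (M : CRep F n) (i : ZMod n) : Module.End F (⨁ j, M.V j) :=
  (lof F (ZMod n) M.V i).comp (component F (ZMod n) M.V i)

lemma proj_lof_self (M : CRep F n) (i : ZMod n) (v : M.V i) :
    M.proj i (lof F (ZMod n) M.V i v) = lof F (ZMod n) M.V i v := by
  simp [proj, component.lof_self]

lemma proj_lof_of_ne (M : CRep F n) {i j : ZMod n} (h : j ≠ i) (v : M.V j) :
    M.proj i (lof F (ZMod n) M.V j v) = 0 := by
  simp [proj, component.of, h]

lemma total_proj (M : CRep F n) (i : ZMod n) (w : ⨁ j, M.V j) :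
    M.total (M.proj i w) = M.proj (i - 1) (M.total w) := by
  suffices M.total.comp (M.proj i) = (M.proj (i - 1)).comp M.total from LinearMap.congr_fun this w
  refine DirectSum.linearMap_ext F fun j => LinearMap.ext fun v => ?_
  simp only [LinearMap.comp_apply]
  by_cases h : j = i
  · subst h
    rw [proj_lof_self, total_lof, proj_lof_self]
  · rw [proj_lof_of_ne _ h, total_lof, proj_lof_of_ne _ (fun e => h (sub_left_injective e)),
      map_zero]

lemma total_pow_proj (M : CRep F n) (t : ℕ) (i : ZMod n) (w : ⨁ j, M.V j) :
    (M.total ^ t) (M.proj i w) = M.proj (i - t) ((M.total ^ t) w) := by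
  induction t with
  | zero => simp
  | succ t ih =>
    have : i - ((t + 1 : ℕ) : ZMod n) = i - t - 1 := by push_cast; ring
    rw [this, pow_succ', Module.End.mul_apply, Module.End.mul_apply, ih, total_proj]

/-! ### Indecomposable nilpotent representations have a one-dimensional socle -/

/-- A cyclic submodule of maximal length of a nilpotent operator has an invariant complement. -/
lemma isCompl_cyclic {A : Type*} [AddCommGroup A] [Module F A] (T : Module.End F A) (r : ℕ)
    (v : A) (l : A →ₗ[F] F) (hT : T ^ (r + 1) = 0) (hl : l ((T ^ r) v) = 1) :
    IsCompl (Submodule.span F (Set.range fun s : ℕ => (T ^ s) v))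
      (⨅ t : ℕ, LinearMap.ker (l.comp (T ^ t))) := by
  have hzero : ∀ t, r + 1 ≤ t → T ^ t = 0 := fun t ht => pow_eq_zero_of_le ht hT
  set P := Submodule.span F (Set.range fun s : ℕ => (T ^ s) v) with hP
  have hgen : ∀ s : ℕ, (T ^ s) v ∈ P := fun s => Submodule.subset_span ⟨s, rfl⟩
  have hdec : ∀ p ∈ P, ∃ c : F, ∃ p' ∈ P, p = c • v + T p' := by
    intro p hp
    induction hp using Submodule.span_induction with
    | mem x hx =>
      obtain ⟨s, rfl⟩ := hx
      rcases s with _ | s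
      · exact ⟨1, 0, P.zero_mem, by simp⟩
      · exact ⟨0, _, hgen s, by simp [pow_succ']⟩
    | zero => exact ⟨0, 0, P.zero_mem, by simp⟩
    | add x y _ _ hx hy =>
      obtain ⟨c, p, hp, rfl⟩ := hx
      obtain ⟨d, q, hq, rfl⟩ := hy
      exact ⟨c + d, p + q, P.add_mem hp hq, by rw [map_add, add_smul]; abel⟩
    | smul a x _ hx =>
      obtain ⟨c, p, hp, rfl⟩ := hx
      exact ⟨a * c, a • p, P.smul_mem _ hp, by rw [map_smul, smul_add, smul_smul]⟩
  constructor
  · rw [Submodule.disjoint_def]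
    intro p hp hpC
    simp only [Submodule.mem_iInf, LinearMap.mem_ker, LinearMap.comp_apply] at hpC
    have key : ∀ k, k ≤ r + 1 → ∃ p' ∈ P, p = (T ^ k) p' := by
      intro k
      induction k with
      | zero => exact fun _ => ⟨p, hp, by simp⟩
      | succ k ih =>
        intro hk
        obtain ⟨p', hp', h⟩ := ih (by omega)
        obtain ⟨c, p'', hp'', rfl⟩ := hdec p' hp'
        have h1 := hpC (r - k)
        have h2 : (T ^ (r - k)) p = c • (T ^ r) v := by
          rw [h, ← Module.End.mul_apply, ← pow_add, Nat.sub_add_cancel (by omega), map_add,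
            map_smul, ← Module.End.mul_apply, ← pow_succ, hT]
          simp
        rw [h2, map_smul, hl, smul_eq_mul, mul_one] at h1
        refine ⟨p'', hp'', ?_⟩
        rw [h, h1, zero_smul, zero_add, pow_succ, Module.End.mul_apply]
    obtain ⟨p', -, h⟩ := key (r + 1) le_rfl
    rw [h, hT]; rfl
  · rw [codisjoint_iff, eq_top_iff]
    intro w _
    have key : ∀ k, k ≤ r + 1 → ∃ p ∈ P, ∀ t, r + 1 ≤ t + k → l ((T ^ t) (w - p)) = 0 := by
      intro k
      induction k with
      | zero => exact fun _ => ⟨0, P.zero_mem, fun t ht => by rw [hzero t ht]; simp⟩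
      | succ k ih =>
        intro hk
        obtain ⟨p, hp, h⟩ := ih (by omega)
        refine ⟨p + l ((T ^ (r - k)) (w - p)) • (T ^ k) v,
          P.add_mem hp (P.smul_mem _ (hgen k)), fun t ht => ?_⟩
        rw [← sub_sub, map_sub, map_sub, map_smul, map_smul, ← Module.End.mul_apply, ← pow_add]
        rcases (show t = r - k ∨ r + 1 ≤ t + k by omega) with rfl | h'
        · rw [Nat.sub_add_cancel (by omega), hl]; simp
        · rw [h t h', hzero _ h']; simp
    obtain ⟨p, hp, h⟩ := key (r + 1) le_rfl
    rw [← add_sub_cancel p w]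
    refine Submodule.add_mem_sup hp ?_
    simp only [Submodule.mem_iInf, LinearMap.mem_ker, LinearMap.comp_apply]
    exact fun t => h t (by omega)

lemma Indecomp.exists_socle {M : CRep F n} (hM : M.IsNilpotentRep) (hI : M.Indecomp) :
    ∃ j₀ : ZMod n, ∀ i, Module.finrank F (LinearMap.ker (M.x i)) = if i = j₀ then 1 else 0 := by
  classical
  have hne : ∃ j, ∃ v : M.V j, v ≠ 0 := by
    by_contra! h
    exact hI.1 fun j => ⟨fun a b => by rw [h j a, h j b]⟩
  have h0 : M.total ^ 0 ≠ 0 := by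
    obtain ⟨j, v, hv⟩ := hne
    intro h
    have := LinearMap.congr_fun h (lof F _ _ j v)
    rw [lof_eq_of] at this
    exact hv (DirectSum.of_injective (β := M.V) j (by simpa using this))
  obtain ⟨r, hr, hr'⟩ : ∃ r, M.total ^ (r + 1) = 0 ∧ M.total ^ r ≠ 0 := by
    have hN := Nat.find_spec hM
    rcases hk : Nat.find hM with _ | r
    · rw [hk] at hN; exact absurd hN h0
    · exact ⟨r, hk ▸ hN, Nat.find_min hM (by omega)⟩
  obtain ⟨j, v, hv⟩ : ∃ j, ∃ v : M.V j, (M.total ^ r) (lof F _ _ j v) ≠ 0 := by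
    by_contra! h
    exact hr' (DirectSum.linearMap_ext F fun j => LinearMap.ext fun v => h j v)
  obtain ⟨j₀, b, hb⟩ : ∃ j₀, ∃ b : M.V j₀, (M.total ^ r) (lof F _ _ j v) = lof F _ _ j₀ b :=
    ⟨_, M.total_pow_lof r j v⟩
  have hinj : ∀ i, Function.Injective (lof F (ZMod n) M.V i) := fun i =>
    DirectSum.of_injective (β := M.V) i
  have hb0 : b ≠ 0 := by
    rintro rfl
    exact hv (by rw [hb, map_zero])
  obtain ⟨g, hg⟩ := Module.Projective.exists_dual_eq_one F hb0
  set l : (⨁ j, M.V j) →ₗ[F] F := g.comp (component F (ZMod n) M.V j₀) with hl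
  have hlproj : ∀ i w, l (M.proj i w) = if i = j₀ then l w else 0 := by
    intro i w
    by_cases h : i = j₀
    · subst h
      simp [hl, proj, component.lof_self]
    · simp [hl, proj, component.of, h]
  have hcompl := isCompl_cyclic M.total r (lof F _ _ j v) l hr
    (by rw [hb]; simpa [hl, component.lof_self] using hg)
  set P := Submodule.span F (Set.range fun s : ℕ => (M.total ^ s) (lof F _ _ j v)) with hP
  set C := ⨅ t : ℕ, LinearMap.ker (l.comp (M.total ^ t)) with hC
  have memC : ∀ w, w ∈ C ↔ ∀ t : ℕ, l ((M.total ^ t) w) = 0 := fun w => by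
    simp [hC, Submodule.mem_iInf]
  have hPT : ∀ w ∈ P, M.total w ∈ P := by
    intro w hw
    induction hw using Submodule.span_induction with
    | mem x hx =>
      obtain ⟨s, rfl⟩ := hx
      exact Submodule.subset_span ⟨s + 1, by simp [pow_succ']⟩
    | zero => simp
    | add x y _ _ hx hy => rw [map_add]; exact P.add_mem hx hy
    | smul a x _ hx => rw [map_smul]; exact P.smul_mem _ hx
  have hPproj : ∀ i, ∀ w ∈ P, M.proj i w ∈ P := by
    intro i w hw
    induction hw using Submodule.span_induction with
    | mem x hx =>
      obtain ⟨s, rfl⟩ := hx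
      have hs : (M.total ^ s) (lof F _ _ j v) ∈ P := Submodule.subset_span ⟨s, rfl⟩
      obtain ⟨w, hw⟩ := M.total_pow_lof s j v
      simp only [hw] at hs ⊢
      by_cases h : j - (s : ZMod n) = i
      · subst h
        rwa [proj_lof_self]
      · rw [proj_lof_of_ne _ h]
        exact P.zero_mem
    | zero => simp
    | add x y _ _ hx hy => rw [map_add]; exact P.add_mem hx hy
    | smul a x _ hx => rw [map_smul]; exact P.smul_mem _ hx
  have hCT : ∀ w ∈ C, M.total w ∈ C := by
    intro w hw
    rw [memC] at hw ⊢
    intro t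
    rw [← Module.End.mul_apply, ← pow_succ]
    exact hw _
  have hCproj : ∀ i, ∀ w ∈ C, M.proj i w ∈ C := by
    intro i w hw
    rw [memC] at hw ⊢
    intro t
    rw [total_pow_proj, hlproj, hw, ite_self]
  have hIso := M.iso_prod_sub (fun i => P.comap (lof F _ _ i)) (fun i => C.comap (lof F _ _ i))
    (fun i w hw => by
      rw [Submodule.mem_comap] at hw ⊢
      rw [← total_lof]
      exact hPT _ hw)
    (fun i w hw => by
      rw [Submodule.mem_comap] at hw ⊢
      rw [← total_lof]
      exact hCT _ hw)
    (fun i => by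
      constructor
      · rw [Submodule.disjoint_def]
        intro w hw hw'
        refine hinj i ?_
        rw [map_zero]
        exact Submodule.disjoint_def.1 hcompl.1 _ hw hw'
      · rw [codisjoint_iff, eq_top_iff]
        intro w _
        obtain ⟨p, hp, c, hc, h⟩ := Submodule.mem_sup.1
          (show lof F _ M.V i w ∈ P ⊔ C from hcompl.sup_eq_top ▸ Submodule.mem_top)
        refine Submodule.mem_sup.2 ⟨component F _ _ i p, hPproj i p hp, component F _ _ i c,
          hCproj i c hc, ?_⟩
        rw [← map_add, h, component.lof_self])
  have hC0 : ∀ i, ∀ w : M.V i, lof F _ _ i w ∈ C → w = 0 := by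
    intro i w hw
    rcases hI.2 _ _ hIso with h | h
    · refine absurd ?_ hv
      have hvP : v ∈ P.comap (lof F _ M.V j) := Submodule.subset_span ⟨0, by simp⟩
      have : v = 0 := congrArg Subtype.val ((h j).elim ⟨v, hvP⟩ 0)
      rw [this]; simp
    · exact congrArg Subtype.val ((h i).elim ⟨w, hw⟩ 0)
  have hker : ∀ i, ∀ w ∈ LinearMap.ker (M.x i), l (lof F _ _ i w) = 0 → w = 0 := by
    intro i w hw hlw
    refine hC0 i w ((memC _).2 fun t => ?_)
    rcases t with _ | t
    · simpa using hlw
    · rw [pow_succ, Module.End.mul_apply, total_lof, LinearMap.mem_ker.1 hw]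
      simp
  refine ⟨j₀, fun i => ?_⟩
  split_ifs with h
  · subst h
    have hbker : b ∈ LinearMap.ker (M.x i) := by
      refine LinearMap.mem_ker.2 (hinj _ ?_)
      rw [← total_lof, ← hb, ← Module.End.mul_apply, ← pow_succ', hr]
      simp
    refine le_antisymm ?_ ?_
    · have := LinearMap.finrank_le_finrank_of_injective
        (f := (l.comp (lof F _ _ i)).comp (LinearMap.ker (M.x i)).subtype)
        ((injective_iff_map_eq_zero _).2 fun w hw => Subtype.ext (hker i w w.2 hw))
      rwa [Module.finrank_self] at this
    · exact Module.finrank_pos_iff_exists_ne_zero.2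
        ⟨⟨b, hbker⟩, fun e => hb0 (congrArg Subtype.val e)⟩
  · rw [Submodule.finrank_eq_zero, Submodule.eq_bot_iff]
    exact fun w hw => hker i w hw (by simp [hl, component.of, h])

/-! ### The number of indecomposable summands -/

/-- The dimension of the socle. -/
def socDim [NeZero n] (M : CRep F n) : ℕ := ∑ j, Module.finrank F (LinearMap.ker (M.x j))

lemma Iso.finrank_ker_eq {M N : CRep F n} (h : M.Iso N) (j : ZMod n) :
    Module.finrank F (LinearMap.ker (M.x j)) = Module.finrank F (LinearMap.ker (N.x j)) := by
  obtain ⟨φ, hφ⟩ := h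
  have hmap : (LinearMap.ker (M.x j)).map
      (LinearEquiv.ofBijective (φ.f j) (hφ j) : M.V j →ₗ[F] N.V j) = LinearMap.ker (N.x j) := by
    ext w
    obtain ⟨v, rfl⟩ := (hφ j).2 w
    rw [LinearMap.mem_ker, ← φ.comm_apply, map_eq_zero_iff _ (hφ (j - 1)).1]
    exact (hφ j).1.mem_set_image
  rw [← hmap, LinearEquiv.finrank_map_eq]

lemma Iso.socDim_eq [NeZero n] {M N : CRep F n} (h : M.Iso N) : M.socDim = N.socDim :=
  Finset.sum_congr rfl fun j _ => h.finrank_ker_eq j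

lemma Iso.isNilpotentRep {M N : CRep F n} (h : M.Iso N) (hM : M.IsNilpotentRep) :
    N.IsNilpotentRep := by
  obtain ⟨φ, hφ⟩ := h.symm
  exact hM.of_injective φ fun j => (hφ j).1

lemma Iso.totalDim_eq [NeZero n] {M N : CRep F n} (h : M.Iso N) : M.totalDim = N.totalDim := by
  obtain ⟨φ, hφ⟩ := h
  exact Finset.sum_congr rfl fun j _ => (LinearEquiv.ofBijective (φ.f j) (hφ j)).finrank_eq

lemma Indecomp.socDim_eq_one [NeZero n] {M : CRep F n} (hM : M.IsNilpotentRep)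
    (hI : M.Indecomp) : M.socDim = 1 := by
  obtain ⟨j₀, h⟩ := hI.exists_socle hM
  simp [socDim, h]

lemma socDim_pi [NeZero n] {ι : Type} [Fintype ι] (W : ι → CRep F n) :
    (pi W).socDim = ∑ i, (W i).socDim := by
  unfold socDim
  rw [Finset.sum_comm]
  refine Finset.sum_congr rfl fun j _ => ?_
  rw [← Module.finrank_pi_fintype F]
  let e : LinearMap.ker ((pi W).x j) ≃ₗ[F] ∀ i, LinearMap.ker ((W i).x j) :=
    { toFun := fun v i => ⟨v.1 i, congrFun (show (pi W).x j v.1 = 0 from v.2) i⟩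
      map_add' := fun _ _ => rfl
      map_smul' := fun _ _ => rfl
      invFun := fun v => ⟨fun i => (v i).1, funext fun i => (v i).2⟩
      left_inv := fun _ => rfl
      right_inv := fun _ => rfl }
  exact e.finrank_eq

/-- The inclusion of a summand. -/
def Hom.single {ι : Type} [Fintype ι] [DecidableEq ι] (W : ι → CRep F n) (i : ι) :
    Hom (W i) (pi W) where
  f j := LinearMap.single F (fun i => (W i).V j) i
  comm j := by
    refine LinearMap.ext fun v => funext fun i' => ?_
    change (Pi.single i ((W i).x j v) : ∀ i, (W i).V (j - 1)) i'
      = (W i').x j ((Pi.single i v : ∀ i, (W i).V j) i')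
    by_cases h : i' = i
    · subst h; simp
    · simp [Pi.single_eq_of_ne h]

lemma hasLen.eq_socDim [NeZero n] {M : CRep F n} {k : ℕ} (hM : M.IsNilpotentRep)
    (h : M.hasLen k) : k = M.socDim := by
  obtain ⟨W, hW, hiso⟩ := h
  have hpi := hiso.isNilpotentRep hM
  have h1 : ∀ i, (W i).socDim = 1 := fun i => (hW i).socDim_eq_one
    (hpi.of_injective (Hom.single W i) fun j => Pi.single_injective (M := fun i => (W i).V j) i)
  rw [hiso.socDim_eq, socDim_pi]
  simp [h1]

lemma Iso.hasLen {M N : CRep F n} (h : M.Iso N) {k : ℕ} (hM : M.hasLen k) : N.hasLen k := by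
  obtain ⟨W, hW, hiso⟩ := hM
  exact ⟨W, hW, h.symm.trans hiso⟩

lemma iso_pi_reindex {ι κ : Type} [Fintype ι] [Fintype κ] (e : κ ≃ ι) (W : ι → CRep F n) :
    (pi W).Iso (pi fun k => W (e k)) := by
  refine ⟨⟨fun j => LinearMap.pi fun k =>
      LinearMap.proj (R := F) (φ := fun i => (W i).V j) (e k), fun j => rfl⟩, fun j => ⟨?_, ?_⟩⟩
  · intro v w h
    funext i
    obtain ⟨k, rfl⟩ := e.surjective i
    exact congrFun h k
  · intro v
    exact (Equiv.piCongrLeft (fun i => (W i).V j) e).surjective.exists.2 ⟨v, funext fun k =>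
      Equiv.piCongrLeft_apply_apply (fun i => (W i).V j) e v k⟩

lemma hasLen_of_iso_pi {ι : Type} [Fintype ι] {M : CRep F n} (W : ι → CRep F n)
    (hW : ∀ i, Indecomp (W i)) (h : M.Iso (pi W)) : M.hasLen (Fintype.card ι) :=
  ⟨fun i => W ((Fintype.equivFin ι).symm i), fun _ => hW _,
    h.trans (iso_pi_reindex (Fintype.equivFin ι).symm W)⟩

lemma hasLen.prod {A B : CRep F n} {a b : ℕ} (hA : A.hasLen a) (hB : B.hasLen b) :
    ∃ k, (A.prod B).hasLen k := by
  obtain ⟨W, hW, φ, hφ⟩ := hA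
  obtain ⟨W', hW', ψ, hψ⟩ := hB
  refine ⟨_, hasLen_of_iso_pi (Sum.elim W W') (by rintro (i | i); exacts [hW i, hW' i])
    ⟨⟨fun j => LinearMap.pi fun s => match s with
      | .inl i => (LinearMap.proj (R := F) (φ := fun i => (W i).V j) i).comp
          ((φ.f j).comp (LinearMap.fst F (A.V j) (B.V j)))
      | .inr i => (LinearMap.proj (R := F) (φ := fun i => (W' i).V j) i).comp
          ((ψ.f j).comp (LinearMap.snd F (A.V j) (B.V j))), fun j => ?_⟩, fun j => ⟨?_, ?_⟩⟩⟩
  · refine LinearMap.ext fun v => funext fun s => ?_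
    rcases s with i | i
    · exact congrFun (φ.comm_apply j v.1) i
    · exact congrFun (ψ.comm_apply j v.2) i
  · intro v w h
    refine Prod.ext ((hφ j).1 (funext fun i => congrFun h (.inl i)))
      ((hψ j).1 (funext fun i => congrFun h (.inr i)))
  · intro v
    obtain ⟨u, hu⟩ := (hφ j).2 fun i => v (.inl i)
    obtain ⟨u', hu'⟩ := (hψ j).2 fun i => v (.inr i)
    refine ⟨(u, u'), funext fun s => ?_⟩
    rcases s with i | i
    · exact congrFun hu i
    · exact congrFun hu' i

lemma totalDim_prod [NeZero n] (A B : CRep F n) :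
    (A.prod B).totalDim = A.totalDim + B.totalDim := by
  unfold totalDim
  rw [← Finset.sum_add_distrib]
  exact Finset.sum_congr rfl fun j _ => Module.finrank_prod (R := F) (M := A.V j) (M' := B.V j)

lemma isZero_of_totalDim_eq_zero [NeZero n] {A : CRep F n} (h : A.totalDim = 0) : A.IsZero :=
  fun j => Module.finrank_zero_iff.1 (Finset.sum_eq_zero_iff.1 h j (Finset.mem_univ _))

lemma exists_hasLen [NeZero n] (M : CRep F n) : ∃ k, M.hasLen k := by
  induction hd : M.totalDim using Nat.strong_induction_on generalizing M with
  | _ d ih =>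
    by_cases hz : M.IsZero
    · refine ⟨_, hasLen_of_iso_pi (ι := Fin 0) (fun _ => M) (fun i => i.elim0)
        ⟨⟨fun j => 0, fun j => ?_⟩, fun j => ⟨?_, ?_⟩⟩⟩
      · simp
      · exact fun v w _ => (hz j).elim v w
      · exact fun v => ⟨0, funext fun i => i.elim0⟩
    by_cases hI : M.Indecomp
    · refine ⟨_, hasLen_of_iso_pi (ι := Unit) (fun _ => M) (fun _ => hI)
        ⟨⟨fun j => LinearMap.pi fun _ => LinearMap.id, fun j => rfl⟩, fun j => ⟨?_, ?_⟩⟩⟩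
      · exact fun v w h => congrFun h ()
      · exact fun v => ⟨v (), rfl⟩
    · simp only [Indecomp, not_and, not_forall, not_or] at hI
      obtain ⟨A, B, hiso, hA, hB⟩ := hI hz
      have h1 := hiso.totalDim_eq
      rw [totalDim_prod] at h1
      have hA' : A.totalDim ≠ 0 := fun h => hA (isZero_of_totalDim_eq_zero h)
      have hB' : B.totalDim ≠ 0 := fun h => hB (isZero_of_totalDim_eq_zero h)
      obtain ⟨a, ha⟩ := ih _ (by omega) A rfl
      obtain ⟨b, hb⟩ := ih _ (by omega) B rfl
      obtain ⟨k, hk⟩ := ha.prod hb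
      exact ⟨k, hiso.symm.hasLen hk⟩

lemma IsNilpotentRep.hasLen_iff [NeZero n] {M : CRep F n} (hM : M.IsNilpotentRep) (k : ℕ) :
    M.hasLen k ↔ M.socDim = k := by
  refine ⟨fun h => (h.eq_socDim hM).symm, fun h => ?_⟩
  obtain ⟨k', hk'⟩ := M.exists_hasLen
  rwa [← h, ← hk'.eq_socDim hM]

/-! ### Extensions and cocycles -/

/-- The differential computing `Hom(M, N)` and `Ext¹(M, N)` as its kernel and cokernel. -/
def diff (M N : CRep F n) :
    (∀ j, M.V j →ₗ[F] N.V j) →ₗ[F] ∀ j, M.V j →ₗ[F] N.V (j - 1) where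
  toFun h j := (N.x j).comp (h j) - (h (j - 1)).comp (M.x j)
  map_add' h h' := by
    funext j
    ext v
    simp only [LinearMap.sub_apply, LinearMap.comp_apply, Pi.add_apply, LinearMap.add_apply,
      map_add]
    abel
  map_smul' c h := by
    funext j
    ext v
    simp [smul_sub]

lemma diff_apply (M N : CRep F n) (h : ∀ j, M.V j →ₗ[F] N.V j) (j : ZMod n) (v : M.V j) :
    diff M N h j v = N.x j (h j v) - h (j - 1) (M.x j v) := rfl

/-- Morphisms are the cocycles of degree zero. -/
def homEquiv (M N : CRep F n) : Hom M N ≃ LinearMap.ker (diff M N) where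
  toFun φ := ⟨φ.f, LinearMap.mem_ker.2 (funext fun j => LinearMap.ext fun v => by
    rw [diff_apply, φ.comm_apply, sub_self]; rfl)⟩
  invFun h := ⟨h.1, fun j => LinearMap.ext fun v => by
    have := LinearMap.congr_fun (congrFun (LinearMap.mem_ker.1 h.2) j) v
    rw [diff_apply] at this
    exact (sub_eq_zero.1 this).symm⟩
  left_inv _ := rfl
  right_inv _ := rfl

/-- The extension of `M` by `N` defined by a cocycle. -/
def extSES {M N : CRep F n} (z : ∀ j, M.V j →ₗ[F] N.V (j - 1)) : SES N M where
  E :=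
    { V := fun j => N.V j × M.V j
      x := fun j => LinearMap.prod ((N.x j).coprod (z j))
        ((M.x j).comp (LinearMap.snd F (N.V j) (M.V j))) }
  i := ⟨fun j => LinearMap.inl F (N.V j) (M.V j), fun j => LinearMap.ext fun v =>
    Prod.ext (show N.x j v = N.x j v + z j 0 by simp) (show (0 : M.V (j - 1)) = M.x j 0 by simp)⟩
  p := ⟨fun j => LinearMap.snd F (N.V j) (M.V j), fun j => rfl⟩
  inj j := LinearMap.inl_injective
  surj j := LinearMap.snd_surjective
  exct j := LinearMap.range_inl F (N.V j) (M.V j)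

lemma BaerEq.bijective {M N : CRep F n} {s s' : SES N M} (φ : Hom s.E s'.E)
    (hi : ∀ j, (φ.f j).comp (s.i.f j) = s'.i.f j) (hp : ∀ j, (s'.p.f j).comp (φ.f j) = s.p.f j)
    (j : ZMod n) : Function.Bijective (φ.f j) := by
  have hi' : ∀ v, φ.f j (s.i.f j v) = s'.i.f j v := LinearMap.congr_fun (hi j)
  have hp' : ∀ v, s'.p.f j (φ.f j v) = s.p.f j v := LinearMap.congr_fun (hp j)
  constructor
  · refine (injective_iff_map_eq_zero _).2 fun e he => ?_
    have h1 : e ∈ LinearMap.range (s.i.f j) := by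
      rw [s.exct, LinearMap.mem_ker, ← hp', he, map_zero]
    obtain ⟨v, rfl⟩ := h1
    rw [hi', map_eq_zero_iff _ (s'.inj j)] at he
    rw [he, map_zero]
  · intro e
    obtain ⟨u, hu⟩ := s.surj j (s'.p.f j e)
    have h1 : e - φ.f j u ∈ LinearMap.range (s'.i.f j) := by
      rw [s'.exct, LinearMap.mem_ker, map_sub, hp', hu, sub_self]
    obtain ⟨v, hv⟩ := h1
    exact ⟨s.i.f j v + u, by rw [map_add, hi', hv, sub_add_cancel]⟩

lemma BaerEq.iso {M N : CRep F n} {s s' : SES N M} (h : BaerEq s s') : s.E.Iso s'.E := by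
  obtain ⟨φ, hi, hp⟩ := h
  exact ⟨φ, BaerEq.bijective φ hi hp⟩

lemma BaerEq.symm {M N : CRep F n} {s s' : SES N M} (h : BaerEq s s') : BaerEq s' s := by
  obtain ⟨φ, hi, hp⟩ := h
  have hb := BaerEq.bijective φ hi hp
  refine ⟨⟨fun j => (LinearEquiv.ofBijective (φ.f j) (hb j)).symm.toLinearMap, fun j => ?_⟩,
    fun j => ?_, fun j => ?_⟩
  · refine LinearMap.ext fun w => ?_
    obtain ⟨v, rfl⟩ := (LinearEquiv.ofBijective (φ.f j) (hb j)).surjective w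
    simp only [LinearMap.comp_apply, LinearEquiv.coe_coe, LinearEquiv.symm_apply_apply]
    rw [LinearEquiv.symm_apply_eq, LinearEquiv.ofBijective_apply, LinearEquiv.ofBijective_apply,
      φ.comm_apply]
  · refine LinearMap.ext fun v => ?_
    simp only [LinearMap.comp_apply, LinearEquiv.coe_coe]
    rw [LinearEquiv.symm_apply_eq, LinearEquiv.ofBijective_apply, ← hi, LinearMap.comp_apply]
  · refine LinearMap.ext fun w => ?_
    obtain ⟨v, rfl⟩ := (LinearEquiv.ofBijective (φ.f j) (hb j)).surjective w
    simp only [LinearMap.comp_apply, LinearEquiv.coe_coe, LinearEquiv.symm_apply_apply]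
    rw [LinearEquiv.ofBijective_apply, ← hp, LinearMap.comp_apply]

lemma BaerEq.trans {M N : CRep F n} {s s' s'' : SES N M} (h : BaerEq s s')
    (h' : BaerEq s' s'') : BaerEq s s'' := by
  obtain ⟨φ, hi, hp⟩ := h
  obtain ⟨ψ, hi', hp'⟩ := h'
  refine ⟨⟨fun j => (ψ.f j).comp (φ.f j), fun j => LinearMap.ext fun v => ?_⟩,
    fun j => ?_, fun j => ?_⟩
  · simp only [LinearMap.comp_apply, φ.comm_apply, ψ.comm_apply]
  · rw [LinearMap.comp_assoc, hi, hi']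
  · rw [← LinearMap.comp_assoc, hp', hp]

lemma BaerEq.refl {M N : CRep F n} (s : SES N M) : BaerEq s s :=
  ⟨⟨fun _ => LinearMap.id, fun _ => rfl⟩, fun _ => rfl, fun _ => rfl⟩

lemma baerEq_extSES_iff {M N : CRep F n} (z z' : ∀ j, M.V j →ₗ[F] N.V (j - 1)) :
    BaerEq (extSES z) (extSES z') ↔ z - z' ∈ LinearMap.range (diff M N) := by
  constructor
  · rintro ⟨φ, hi, hp⟩
    refine ⟨fun j => (LinearMap.fst F (N.V j) (M.V j)).comp
      ((φ.f j).comp (LinearMap.inr F (N.V j) (M.V j))), ?_⟩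
    have hφ : ∀ j (a : N.V j) (b : M.V j), φ.f j ((a, b) : N.V j × M.V j)
        = ((a + (show N.V j × M.V j from φ.f j ((0, b) : N.V j × M.V j)).1, b) :
          N.V j × M.V j) := by
      intro j a b
      have h1 : φ.f j ((a, 0) : N.V j × M.V j) = ((a, 0) : N.V j × M.V j) :=
        LinearMap.congr_fun (hi j) a
      have h2 : (show N.V j × M.V j from φ.f j ((0, b) : N.V j × M.V j)).2 = b :=
        LinearMap.congr_fun (hp j) ((0, b) : N.V j × M.V j)
      have h3 : ((a, b) : N.V j × M.V j) = (a, 0) + (0, b) := by simp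
      rw [h3]
      refine ((φ.f j).map_add _ _).trans ?_
      rw [h1]
      exact Prod.ext rfl ((zero_add _).trans h2)
    funext j
    refine LinearMap.ext fun m => ?_
    have h1 := φ.comm_apply j ((0, m) : N.V j × M.V j)
    have h2 : (extSES z).E.x j ((0, m) : N.V j × M.V j)
        = ((z j m, M.x j m) : N.V (j - 1) × M.V (j - 1)) :=
      Prod.ext (show N.x j 0 + z j m = z j m by simp) rfl
    rw [h2, hφ, hφ j 0 m] at h1
    have h3 : z j m + (show N.V (j - 1) × M.V (j - 1) from
        φ.f (j - 1) ((0, M.x j m) : N.V (j - 1) × M.V (j - 1))).1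
        = N.x j (0 + (show N.V j × M.V j from φ.f j ((0, m) : N.V j × M.V j)).1) + z' j m :=
      congrArg Prod.fst h1
    rw [zero_add] at h3
    exact sub_eq_sub_iff_add_eq_add.2 h3.symm
  · rintro ⟨h, hh⟩
    refine ⟨⟨fun j => LinearMap.prod (LinearMap.coprod LinearMap.id (h j))
      (LinearMap.snd F (N.V j) (M.V j)), fun j => LinearMap.ext fun v => Prod.ext ?_ rfl⟩,
      fun j => LinearMap.ext fun v => Prod.ext ?_ rfl, fun j => rfl⟩
    · obtain ⟨a, b⟩ := v
      change N.x j a + z j b + h (j - 1) (M.x j b) = N.x j (a + h j b) + z' j b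
      have := LinearMap.congr_fun (congrFun hh j) b
      rw [diff_apply] at this
      have h4 : N.x j (h j b) - h (j - 1) (M.x j b) = z j b - z' j b := this
      rw [map_add, add_assoc, add_assoc, add_right_inj]
      exact (sub_eq_sub_iff_add_eq_add.1 h4).symm
    · change v + h j 0 = v
      simp

lemma exists_baerEq_extSES {M N : CRep F n} (s : SES N M) :
    ∃ z : ∀ j, M.V j →ₗ[F] N.V (j - 1), BaerEq (extSES z) s := by
  have hσ : ∀ j, ∃ g, (s.p.f j).comp g = LinearMap.id := fun j =>
    LinearMap.exists_rightInverse_of_surjective _ (LinearMap.range_eq_top.2 (s.surj j))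
  have hρ : ∀ j, ∃ g : s.E.V j →ₗ[F] N.V j, g.comp (s.i.f j) = LinearMap.id := fun j =>
    LinearMap.exists_leftInverse_of_injective _ (LinearMap.ker_eq_bot.2 (s.inj j))
  choose σ hσ using hσ
  choose ρ hρ using hρ
  have hσ' : ∀ j v, s.p.f j (σ j v) = v := fun j => LinearMap.congr_fun (hσ j)
  have hρ' : ∀ j v, ρ j (s.i.f j v) = v := fun j => LinearMap.congr_fun (hρ j)
  let z : ∀ j, M.V j →ₗ[F] N.V (j - 1) := fun j =>
    (ρ (j - 1)).comp ((s.E.x j).comp (σ j) - (σ (j - 1)).comp (M.x j))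
  have hz : ∀ j m, s.i.f (j - 1) (z j m) = s.E.x j (σ j m) - σ (j - 1) (M.x j m) := by
    intro j m
    have h1 : s.E.x j (σ j m) - σ (j - 1) (M.x j m) ∈ LinearMap.range (s.i.f (j - 1)) := by
      rw [s.exct, LinearMap.mem_ker, map_sub, s.p.comm_apply, hσ', hσ', sub_self]
    obtain ⟨a, ha⟩ := h1
    change s.i.f (j - 1) (ρ (j - 1) (s.E.x j (σ j m) - σ (j - 1) (M.x j m))) = _
    rw [← ha, hρ']
  refine ⟨z, ⟨fun j => (s.i.f j).coprod (σ j), fun j => LinearMap.ext fun v => ?_⟩,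
    fun j => LinearMap.ext fun v => ?_, fun j => LinearMap.ext fun v => ?_⟩
  · obtain ⟨a, b⟩ := v
    change s.i.f (j - 1) (N.x j a + z j b) + σ (j - 1) (M.x j b)
      = s.E.x j (s.i.f j a + σ j b)
    rw [map_add, map_add, hz, s.i.comm_apply, add_assoc, sub_add_cancel]
  · change s.i.f j v + σ j 0 = s.i.f j v
    simp
  · obtain ⟨a, b⟩ := v
    change s.p.f j (s.i.f j a + σ j b) = b
    have h1 : s.i.f j a ∈ LinearMap.ker (s.p.f j) := by
      rw [← s.exct]; exact ⟨a, rfl⟩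
    rw [map_add, hσ', LinearMap.mem_ker.1 h1, zero_add]

lemma extCount_eq {M N : CRep F n} (P : CRep F n → Prop)
    (hP : ∀ A B : CRep F n, A.Iso B → P A → P B)
    (G : Submodule F (∀ j, M.V j →ₗ[F] N.V (j - 1))) (hG : ∀ z, P (extSES z).E ↔ z ∈ G) :
    extCount N M P = Nat.card (G ⧸ (LinearMap.range (diff M N)).comap G.subtype) := by
  have hequiv : Equivalence fun s s' : {s : SES N M // P s.E} => BaerEq s.1 s'.1 :=
    ⟨fun _ => .refl _, fun h => h.symm, fun h h' => h.trans h'⟩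
  symm
  refine Nat.card_eq_of_bijective (Quotient.lift (fun z : G => Quot.mk _
      (⟨extSES z.1, (hG z.1).2 z.2⟩ : {s : SES N M // P s.E})) fun z z' h =>
      (hequiv.quot_mk_eq_iff _ _).2 ((baerEq_extSES_iff _ _).2 ?_)) ⟨?_, ?_⟩
  · exact (Submodule.quotientRel_def ((LinearMap.range (diff M N)).comap G.subtype)).1 h
  · rintro ⟨z⟩ ⟨z'⟩ h
    exact (Submodule.Quotient.eq _).2
      ((baerEq_extSES_iff _ _).1 ((hequiv.quot_mk_eq_iff _ _).1 h))
  · rintro ⟨s, hs⟩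
    obtain ⟨z, hz⟩ := exists_baerEq_extSES s
    exact ⟨Submodule.Quotient.mk ⟨z, (hG z).1 (hP _ _ hz.symm.iso hs)⟩,
      (hequiv.quot_mk_eq_iff _ _).2 hz⟩

lemma finrank_ker_extSES {M N : CRep F n} (z : ∀ j, M.V j →ₗ[F] N.V (j - 1)) (j : ZMod n) :
    Module.finrank F (LinearMap.ker ((extSES z).E.x j)) = Module.finrank F (LinearMap.ker (N.x j))
      + Module.finrank F
        (LinearMap.ker (M.x j) ⊓ (LinearMap.range (N.x j)).comap (z j) : Submodule F (M.V j)) := by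
  set X : (N.V j × M.V j) →ₗ[F] (N.V (j - 1) × M.V (j - 1)) :=
    LinearMap.prod ((N.x j).coprod (z j)) ((M.x j).comp (LinearMap.snd F (N.V j) (M.V j))) with hX
  have hXa : ∀ a b, X (a, b) = (N.x j a + z j b, M.x j b) := fun a b => rfl
  change Module.finrank F (LinearMap.ker X) = _
  set p : LinearMap.ker X →ₗ[F] M.V j :=
    (LinearMap.snd F (N.V j) (M.V j)).comp (LinearMap.ker X).subtype with hp
  have h1 : LinearMap.range p
      = LinearMap.ker (M.x j) ⊓ (LinearMap.range (N.x j)).comap (z j) := by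
    ext m
    constructor
    · rintro ⟨⟨⟨a, b⟩, hab⟩, rfl⟩
      rw [LinearMap.mem_ker, hXa, Prod.mk_eq_zero] at hab
      refine ⟨hab.2, -a, ?_⟩
      rw [map_neg]
      exact neg_eq_of_add_eq_zero_right hab.1
    · rintro ⟨h, a, ha⟩
      refine ⟨⟨(-a, m), ?_⟩, rfl⟩
      rw [LinearMap.mem_ker, hXa, map_neg, ha, neg_add_cancel, LinearMap.mem_ker.1 h]
      rfl
  let e : LinearMap.ker (N.x j) ≃ₗ[F] LinearMap.ker p :=
    { toFun := fun a => ⟨⟨(a.1, 0), by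
        rw [LinearMap.mem_ker, hXa, LinearMap.mem_ker.1 a.2]; simp⟩, rfl⟩
      map_add' := fun a b => Subtype.ext (Subtype.ext (Prod.ext rfl (add_zero _).symm))
      map_smul' := fun c a => Subtype.ext (Subtype.ext (Prod.ext rfl (smul_zero _).symm))
      invFun := fun w => ⟨w.1.1.1, by
        have h := LinearMap.mem_ker.1 w.1.2
        have h0 : w.1.1.2 = 0 := w.2
        have h' : X (w.1.1.1, w.1.1.2) = 0 := h
        rw [hXa, Prod.mk_eq_zero, h0, map_zero, add_zero] at h'
        exact h'.1⟩
      left_inv := fun _ => rfl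
      right_inv := fun w => Subtype.ext (Subtype.ext (Prod.ext rfl
        (show w.1.1.2 = 0 from w.2).symm)) }
  rw [← LinearMap.finrank_range_add_finrank_ker p, h1, e.finrank_eq, add_comm]

lemma socDim_extSES_iff [NeZero n] {M N : CRep F n} (z : ∀ j, M.V j →ₗ[F] N.V (j - 1)) :
    (extSES z).E.socDim = N.socDim + M.socDim ↔
      ∀ j, ∀ m ∈ LinearMap.ker (M.x j), z j m ∈ LinearMap.range (N.x j) := by
  have hle : ∀ j, Module.finrank F
      (LinearMap.ker (M.x j) ⊓ (LinearMap.range (N.x j)).comap (z j) : Submodule F (M.V j))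
      ≤ Module.finrank F (LinearMap.ker (M.x j)) := fun j =>
    Submodule.finrank_mono inf_le_left
  simp only [socDim, finrank_ker_extSES, Finset.sum_add_distrib, add_right_inj]
  rw [Finset.sum_eq_sum_iff_of_le fun j _ => hle j]
  refine ⟨fun h j m hm => ?_, fun h j _ => ?_⟩
  · have := Submodule.eq_of_le_of_finrank_eq inf_le_left (h j (Finset.mem_univ j))
    rw [← this] at hm
    exact hm.2
  · rw [inf_eq_left.2 fun m hm => h j m hm]

/-! ### The perpendicularity condition -/

/-- The simple representation supported at the vertex `j`. -/
def simple (F : Type) [Field F] {n : ℕ} (j : ZMod n) : CRep F n where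
  V i := (if i = j then ⊤ else ⊥ : Submodule F F)
  x _ := 0

/-- The coordinate on a simple representation. -/
def simpleMk (j : ZMod n) {A : Type} [AddCommGroup A] [Module F A] (f : A →ₗ[F] F) :
    A →ₗ[F] (simple F j).V j :=
  f.codRestrict (if j = j then ⊤ else ⊥ : Submodule F F) fun v => by simp

lemma simpleMk_eq_zero (j : ZMod n) {A : Type} [AddCommGroup A] [Module F A] (f : A →ₗ[F] F)
    (v : A) : simpleMk j f v = 0 ↔ f v = 0 :=
  ⟨fun h => congrArg Subtype.val h, fun h => Subtype.ext h⟩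

lemma finrank_simple (j i : ZMod n) :
    Module.finrank F ((simple F j).V i) = if i = j then 1 else 0 := by
  change Module.finrank F (if i = j then ⊤ else ⊥ : Submodule F F) = _
  by_cases h : i = j
  · rw [if_pos h, if_pos h, finrank_top, Module.finrank_self]
  · rw [if_neg h, if_neg h, finrank_bot]

lemma isSja_simple [NeZero n] (j : ZMod n) : IsSja j 1 (simple F j) := by
  have hpos : ∀ A : CRep F n, ¬ A.IsZero → 1 ≤ A.totalDim := fun A hA =>
    Nat.one_le_iff_ne_zero.2 fun h => hA (isZero_of_totalDim_eq_zero h)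
  have htot : (simple F j).totalDim = 1 := by
    simp [totalDim, finrank_simple]
  rw [IsSja, if_neg one_ne_zero]
  refine ⟨⟨1, ?_⟩, ⟨fun h => ?_, fun A B h => ?_⟩, htot, fun h => ?_⟩
  · refine DirectSum.linearMap_ext F fun i => LinearMap.ext fun v => ?_
    rw [pow_one, LinearMap.comp_apply, total_lof]
    change lof F _ _ (i - 1) 0 = 0
    rw [map_zero]
  · have := finrank_simple (F := F) j j
    rw [if_pos rfl, Module.finrank_zero_iff.2 (h j)] at this
    exact zero_ne_one this
  · by_contra! hAB
    have h1 := h.totalDim_eq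
    rw [htot, totalDim_prod] at h1
    have := hpos A hAB.1
    have := hpos B hAB.2
    omega
  · have h1 : Module.finrank F ((simple F j).V (j + 1 - 1)) = 1 := by
      rw [finrank_simple, if_pos (by ring)]
    obtain ⟨v, hv⟩ := Module.finrank_pos_iff_exists_ne_zero.1 (h1.symm ▸ zero_lt_one)
    obtain ⟨u, hu⟩ := h v
    exact hv hu.symm

lemma surjective_of_subsingleton_hom_simple (M : CRep F n) (j : ZMod n)
    (h : Subsingleton (Hom M (simple F (j - 1)))) : Function.Surjective (M.x j) := by
  rw [← LinearMap.range_eq_top]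
  by_contra hne
  obtain ⟨v, hv⟩ := SetLike.exists_not_mem_of_ne_top _ hne
  obtain ⟨f, hfv, hf⟩ := Submodule.exists_dual_map_eq_bot_of_notMem hv inferInstance
  have hf0 : ∀ u, f (M.x j u) = 0 := fun u => by
    have : f (M.x j u) ∈ (LinearMap.range (M.x j)).map f := ⟨_, ⟨u, rfl⟩, rfl⟩
    rwa [hf, Submodule.mem_bot] at this
  let φ : Hom M (simple F (j - 1)) :=
    { f := Pi.single (j - 1) (simpleMk (j - 1) f)
      comm := fun i => by
        refine LinearMap.ext fun u => ?_
        change (Pi.single (j - 1) (simpleMk (j - 1) f) :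
          ∀ i, M.V i →ₗ[F] (simple F (j - 1)).V i) (i - 1) (M.x i u) = 0
        by_cases hi : i = j
        · subst hi
          rw [Pi.single_eq_same, simpleMk_eq_zero, hf0]
        · rw [Pi.single_eq_of_ne fun e => hi (sub_left_injective e)]
          rfl }
  let ψ : Hom M (simple F (j - 1)) := ⟨0, fun i => by ext; rfl⟩
  have h1 : φ.f (j - 1) v = ψ.f (j - 1) v := by rw [h.elim φ ψ]
  have h2 : φ.f (j - 1) v = simpleMk (j - 1) f v := by
    change (Pi.single (j - 1) (simpleMk (j - 1) f) :
          ∀ i, M.V i →ₗ[F] (simple F (j - 1)).V i) (j - 1) v = _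
    rw [Pi.single_eq_same]
  exact hfv ((simpleMk_eq_zero _ _ _).1 (h2.symm.trans h1))

lemma injective_of_splits_simple (M : CRep F n) (j : ZMod n)
    (h : ∀ s : SES (simple F (j - 1)) M, s.Splits) : Function.Injective (M.x j) := by
  refine (injective_iff_map_eq_zero _).2 fun m hm => ?_
  by_contra hne
  obtain ⟨f, hf⟩ := Module.Projective.exists_dual_eq_one F hne
  let z : ∀ i, M.V i →ₗ[F] (simple F (j - 1)).V (i - 1) := Pi.single j (simpleMk (j - 1) f)
  obtain ⟨σ, hσ⟩ := h (extSES z)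
  have h1 : (show (simple F (j - 1)).V j × M.V j from σ.f j m).2 = m :=
    LinearMap.congr_fun (hσ j) m
  have h2 := congrArg Prod.fst (σ.comm_apply j m)
  rw [hm, map_zero] at h2
  have h3 : (0 : (simple F (j - 1)).V (j - 1)) = 0 + z j
    (show (simple F (j - 1)).V j × M.V j from σ.f j m).2 := h2
  rw [h1, zero_add] at h3
  have h4 : z j m = simpleMk (j - 1) f m := by
    change (Pi.single j (simpleMk (j - 1) f) :
      ∀ i, M.V i →ₗ[F] (simple F (j - 1)).V (i - 1)) j m = _
    rw [Pi.single_eq_same]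
  rw [h4, eq_comm, simpleMk_eq_zero, hf] at h3
  exact one_ne_zero h3

/-! ### The structure of `S_0^{(b)}` for `b ≡ -1` modulo `n` -/

lemma finrank_range_add_coker (N : CRep F n) (j : ZMod n) :
    Module.finrank F (N.V (j - 1) ⧸ LinearMap.range (N.x j)) + Module.finrank F (N.V j)
      = Module.finrank F (N.V (j - 1)) + Module.finrank F (LinearMap.ker (N.x j)) := by
  have h1 := Submodule.finrank_quotient_add_finrank (LinearMap.range (N.x j))
  have h2 := LinearMap.finrank_range_add_finrank_ker (N.x j)
  omega

lemma sum_finrank_coker [NeZero n] (N : CRep F n) :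
    ∑ j, Module.finrank F (N.V (j - 1) ⧸ LinearMap.range (N.x j)) = N.socDim := by
  have h := Finset.sum_congr (s₁ := Finset.univ) rfl fun j _ => N.finrank_range_add_coker j
  have hs : ∑ j, Module.finrank F (N.V (j - 1)) = ∑ j, Module.finrank F (N.V j) :=
    Equiv.sum_comp (Equiv.subRight (1 : ZMod n)) fun j => Module.finrank F (N.V j)
  rw [Finset.sum_add_distrib, Finset.sum_add_distrib, hs] at h
  unfold socDim
  omega

lemma finrank_coker_eq_zero_iff (N : CRep F n) (j : ZMod n) :
    Module.finrank F (N.V (j - 1) ⧸ LinearMap.range (N.x j)) = 0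
      ↔ Function.Surjective (N.x j) := by
  rw [Module.finrank_zero_iff, Submodule.Quotient.subsingleton_iff,
    LinearMap.range_eq_top]

/-- The properties of `S_0^{(b)}`, `b ≡ -1` modulo `n`, used in the counting argument. -/
structure IsUniserial [NeZero n] (N : CRep F n) : Prop where
  nilp : N.IsNilpotentRep
  socDim : N.socDim = 1
  surj : ∀ j, j ≠ 1 → Function.Surjective (N.x j)
  coker : Module.finrank F (N.V (1 - 1) ⧸ LinearMap.range (N.x 1)) = 1
  dim : ∀ j, Module.finrank F (N.V (j - 1)) + (if j = 2 then 1 else 0)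
    = Module.finrank F (N.V j) + if j = 1 then 1 else 0

lemma IsSja.isUniserial [NeZero n] {N : CRep F n} {b : ℕ} (hb : b ≠ 0)
    (hbn : (b : ZMod n) = -1) (h : IsSja (0 : ZMod n) b N) : N.IsUniserial := by
  rw [IsSja, if_neg hb, zero_add] at h
  obtain ⟨hnil, hI, hdim, hns⟩ := h
  obtain ⟨j₀, hj₀⟩ := hI.exists_socle hnil
  have hsoc := hI.socDim_eq_one hnil
  have hsum := N.sum_finrank_coker
  rw [hsoc] at hsum
  have h1 := (finrank_coker_eq_zero_iff N 1).not.2 hns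
  rw [← Finset.add_sum_erase _ _ (Finset.mem_univ (1 : ZMod n))] at hsum
  have hcoker : ∀ j, Module.finrank F (N.V (j - 1) ⧸ LinearMap.range (N.x j))
      = if j = 1 then 1 else 0 := by
    intro j
    split_ifs with hj
    · subst hj
      omega
    · exact Finset.sum_eq_zero_iff.1 (by omega : ∑ j ∈ Finset.univ.erase (1 : ZMod n),
        Module.finrank F (N.V (j - 1) ⧸ LinearMap.range (N.x j)) = 0) j
        (Finset.mem_erase.2 ⟨hj, Finset.mem_univ j⟩)
  have hd : ∀ j, (if j = 1 then 1 else 0) + Module.finrank F (N.V j)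
      = Module.finrank F (N.V (j - 1)) + if j = j₀ then 1 else 0 := fun j => by
    rw [← hcoker, ← hj₀, finrank_range_add_coker]
  have hj2 : j₀ = 2 := by
    have h2 : ∑ j : ZMod n, j * ((if j = 1 then 1 else 0) + (Module.finrank F (N.V j) : ZMod n))
        = ∑ j : ZMod n, j * ((Module.finrank F (N.V (j - 1)) : ZMod n)
          + if j = j₀ then 1 else 0) := by
      refine Finset.sum_congr rfl fun j _ => ?_
      have := congrArg (Nat.cast : ℕ → ZMod n) (hd j)
      push_cast at this
      rw [this]
    have h3 : ∑ j : ZMod n, j * (Module.finrank F (N.V (j - 1)) : ZMod n)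
        = ∑ j : ZMod n, (j + 1) * (Module.finrank F (N.V j) : ZMod n) := by
      rw [← Equiv.sum_comp (Equiv.subRight (1 : ZMod n))
        fun j => (j + 1) * (Module.finrank F (N.V j) : ZMod n)]
      refine Finset.sum_congr rfl fun j _ => ?_
      rw [Equiv.subRight_apply, sub_add_cancel]
    have h4 : ∑ j : ZMod n, (Module.finrank F (N.V j) : ZMod n) = -1 := by
      rw [← hbn, ← hdim, totalDim, Nat.cast_sum]
    simp only [mul_add, Finset.sum_add_distrib, h3, add_mul, one_mul, h4] at h2
    simp only [mul_ite, mul_one, mul_zero, Finset.sum_ite_eq', Finset.mem_univ, if_true] at h2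
    linear_combination -h2
  subst hj2
  refine ⟨hnil, hsoc, fun j hj => ?_, by rw [hcoker, if_pos rfl], fun j => ?_⟩
  · rw [← finrank_coker_eq_zero_iff, hcoker, if_neg hj]
  · rw [← hd, add_comm]

/-! ### Counting -/

/-- The cocycles whose extension has the largest possible socle. -/
def socleSplit (M N : CRep F n) : Submodule F (∀ j, M.V j →ₗ[F] N.V (j - 1)) where
  carrier := {z | ∀ j, ∀ m ∈ LinearMap.ker (M.x j), z j m ∈ LinearMap.range (N.x j)}
  add_mem' hz hw j m hm := add_mem (hz j m hm) (hw j m hm)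
  zero_mem' _ _ _ := zero_mem _
  smul_mem' c _ hz j m hm := Submodule.smul_mem _ c (hz j m hm)

lemma range_diff_le_socleSplit (M N : CRep F n) :
    LinearMap.range (diff M N) ≤ socleSplit M N := by
  rintro _ ⟨φ, rfl⟩ j m hm
  rw [LinearMap.mem_ker] at hm
  rw [diff_apply]
  simp [hm]

/-- The obstruction at the vertex `1` for a cocycle to lie in `socleSplit`. -/
def obstruction (M N : CRep F n) : (∀ j, M.V j →ₗ[F] N.V (j - 1)) →ₗ[F]
    (LinearMap.ker (M.x 1) →ₗ[F] N.V (1 - 1) ⧸ LinearMap.range (N.x 1)) where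
  toFun z := (LinearMap.range (N.x 1)).mkQ ∘ₗ z 1 ∘ₗ (LinearMap.ker (M.x 1)).subtype
  map_add' _ _ := by ext; simp
  map_smul' _ _ := by ext; simp

lemma obstruction_surjective (M N : CRep F n) : Function.Surjective (obstruction M N) := by
  intro g
  obtain ⟨g', hg'⟩ := g.exists_extend
  obtain ⟨s, hs⟩ := (LinearMap.range (N.x 1)).mkQ.exists_rightInverse_of_surjective
    (Submodule.range_mkQ _)
  refine ⟨Pi.single 1 (s ∘ₗ g'), ?_⟩
  change (LinearMap.range (N.x 1)).mkQ ∘ₗ (Pi.single 1 (s ∘ₗ g') :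
    ∀ j, M.V j →ₗ[F] N.V (j - 1)) 1 ∘ₗ (LinearMap.ker (M.x 1)).subtype = g
  rw [Pi.single_eq_same, LinearMap.comp_assoc, hg', ← LinearMap.comp_assoc, hs,
    LinearMap.id_comp]

lemma finrank_eq_of_perp {M : CRep F n}
    (h : ∀ j : ℕ, 2 ≤ j → j ≤ n - 1 → Function.Bijective (M.x ((j : ZMod n) + 1)))
    (hn : 2 ≤ n) : Module.finrank F (M.V 2) = Module.finrank F (M.V (1 - 1)) := by
  have key : ∀ j : ℕ, 2 ≤ j → j ≤ n →
      Module.finrank F (M.V 2) = Module.finrank F (M.V (j : ZMod n)) := by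
    intro j hj
    induction j, hj using Nat.le_induction with
    | base => intro _; rw [Nat.cast_ofNat]
    | succ j hj ih =>
      intro hjn
      rw [ih (by omega), Nat.cast_succ,
        (LinearEquiv.ofBijective _ (h j hj (by omega))).finrank_eq, add_sub_cancel_right]
  rw [key n hn le_rfl, ZMod.natCast_self, sub_self]

lemma one_ne_two_of_two_le (hn : 2 ≤ n) : (1 : ZMod n) ≠ 2 := by
  have : Fact (1 < n) := ⟨hn⟩
  intro h
  exact one_ne_zero (α := ZMod n) (by linear_combination -h)

section

variable [NeZero n] {M N : CRep F n}

lemma IsUniserial.socleSplit_eq (hN : N.IsUniserial) :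
    socleSplit M N = LinearMap.ker (obstruction M N) := by
  ext z
  constructor
  · intro hz
    refine LinearMap.ext fun m => ?_
    exact (Submodule.Quotient.mk_eq_zero _).2 (hz 1 m m.2)
  · intro hz j m hm
    by_cases hj : j = 1
    · subst hj
      exact (Submodule.Quotient.mk_eq_zero _).1
        (LinearMap.congr_fun (LinearMap.mem_ker.1 hz) ⟨m, hm⟩)
    · exact hN.surj j hj _

lemma IsUniserial.finrank_socleSplit (hN : N.IsUniserial) :
    Module.finrank F (socleSplit M N) + Module.finrank F (LinearMap.ker (M.x 1))
      = ∑ j, Module.finrank F (M.V j) * Module.finrank F (N.V (j - 1)) := by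
  have h := LinearMap.finrank_range_add_finrank_ker (obstruction M N)
  rw [← hN.socleSplit_eq, LinearMap.range_eq_top.2 (obstruction_surjective M N), finrank_top,
    Module.finrank_linearMap, hN.coker, mul_one, Module.finrank_pi_fintype] at h
  simp only [Module.finrank_linearMap] at h
  omega

/-- The Euler form of `M` against a uniserial `N`, in terms of dimension vectors. -/
lemma IsUniserial.sum_dim (hN : N.IsUniserial) :
    ∑ j, Module.finrank F (M.V j) * Module.finrank F (N.V (j - 1)) + Module.finrank F (M.V 2)
      = ∑ j, Module.finrank F (M.V j) * Module.finrank F (N.V j)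
        + Module.finrank F (M.V 1) := by
  have h := Finset.sum_congr (s₁ := Finset.univ) rfl fun j _ =>
    congrArg (Module.finrank F (M.V j) * ·) (hN.dim j)
  simpa [mul_add, Finset.sum_add_distrib] using h

lemma finrank_quotient_comap_add {W : Type} [AddCommGroup W] [Module F W] [Module.Finite F W]
    {B G : Submodule F W} (h : B ≤ G) :
    Module.finrank F (G ⧸ B.comap G.subtype) + Module.finrank F B = Module.finrank F G := by
  rw [← (Submodule.comapSubtypeEquivOfLe h).finrank_eq]
  exact Submodule.finrank_quotient_add_finrank _

lemma IsUniserial.finrank_add_eq (hN : N.IsUniserial)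
    (h02 : Module.finrank F (M.V 2) = Module.finrank F (M.V (1 - 1))) :
    Module.finrank F
        (socleSplit M N ⧸ (LinearMap.range (diff M N)).comap (socleSplit M N).subtype)
      + Module.finrank F (M.V (1 - 1) ⧸ LinearMap.range (M.x 1))
      = Module.finrank F (LinearMap.ker (diff M N)) := by
  have h1 := finrank_quotient_comap_add (range_diff_le_socleSplit M N)
  have h2 := LinearMap.finrank_range_add_finrank_ker (diff M N)
  rw [Module.finrank_pi_fintype] at h2
  simp only [Module.finrank_linearMap] at h2
  have h3 := hN.finrank_socleSplit (M := M)
  have h4 := hN.sum_dim (M := M)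
  have h5 := M.finrank_range_add_coker 1
  omega

lemma homCount_eq [Fintype F] (M N : CRep F n) :
    homCount M N = Nat.card F ^ Module.finrank F (LinearMap.ker (diff M N)) := by
  rw [homCount, Nat.card_congr (homEquiv M N), Module.natCard_eq_pow_finrank (K := F)]

lemma IsUniserial.extCount_hasLen [Fintype F] (hN : N.IsUniserial) (hM : M.IsNilpotentRep)
    {k : ℕ} (hk : M.hasLen k) :
    extCount N M (fun E => E.hasLen (k + 1)) = Nat.card F ^ Module.finrank F
      (socleSplit M N ⧸ (LinearMap.range (diff M N)).comap (socleSplit M N).subtype) := by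
  rw [extCount_eq _ (fun A B h => (h.hasLen ·)) (socleSplit M N) fun z => ?_,
    Module.natCard_eq_pow_finrank (K := F)]
  rw [((extSES z).isNilpotentRep hN.nilp hM).hasLen_iff, add_comm, ← (hM.hasLen_iff k).1 hk,
    ← hN.socDim, socDim_extSES_iff]
  rfl

/-! ### The case of `S_0^{(n-1)}` -/

lemma IsUniserial.finrank_one_eq_zero (hN : N.IsUniserial) (htot : N.totalDim < n) :
    Module.finrank F (N.V 1) = 0 := by
  by_contra h0
  have key : ∀ t : ℕ, 1 ≤ t → t ≤ n → 1 ≤ Module.finrank F (N.V (t : ZMod n)) := by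
    intro t ht
    induction t, ht using Nat.le_induction with
    | base => intro _; rw [Nat.cast_one]; omega
    | succ t ht ih =>
      intro htn
      have h1 := hN.dim ((t + 1 : ℕ) : ZMod n)
      have h2 : ((t + 1 : ℕ) : ZMod n) - 1 = t := by push_cast; ring
      rw [h2] at h1
      have h3 := ih (by omega)
      by_cases h4 : ((t + 1 : ℕ) : ZMod n) = 1
      · rw [h4]
        omega
      · rw [if_neg h4] at h1
        omega
  have hall : ∀ j : ZMod n, 1 ≤ Module.finrank F (N.V j) := fun j => by
    by_cases hj : j.val = 0
    · rw [(ZMod.val_eq_zero j).1 hj, ← ZMod.natCast_self n]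
      exact key n (Nat.one_le_iff_ne_zero.2 (NeZero.ne n)) le_rfl
    · rw [← ZMod.natCast_zmod_val j]
      exact key _ (by omega) j.val_lt.le
  have : ∑ _j : ZMod n, 1 ≤ N.totalDim := Finset.sum_le_sum fun j _ => hall j
  rw [Finset.sum_const, Finset.card_univ, ZMod.card, smul_eq_mul, mul_one] at this
  omega

lemma finrank_ker_diff_le (hn : 2 ≤ n)
    (h : ∀ j : ℕ, 2 ≤ j → j ≤ n - 1 → Function.Surjective (M.x ((j : ZMod n) + 1)))
    (h1 : Module.finrank F (N.V 1) = 0) (h0 : Module.finrank F (N.V (1 - 1)) = 1) :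
    Module.finrank F (LinearMap.ker (diff M N))
      ≤ Module.finrank F (M.V (1 - 1) ⧸ LinearMap.range (M.x 1)) := by
  have := Module.finrank_zero_iff.1 h1
  obtain ⟨s, hs⟩ := (LinearMap.range (M.x 1)).mkQ.exists_rightInverse_of_surjective
    (Submodule.range_mkQ _)
  let Φ : LinearMap.ker (diff M N) →ₗ[F]
      ((M.V (1 - 1) ⧸ LinearMap.range (M.x 1)) →ₗ[F] N.V (1 - 1)) :=
    { toFun := fun φ => φ.1 (1 - 1) ∘ₗ s
      map_add' := fun _ _ => rfl
      map_smul' := fun _ _ => rfl }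
  suffices hΦ : Function.Injective Φ by
    have := LinearMap.finrank_le_finrank_of_injective hΦ
    rwa [Module.finrank_linearMap, h0, mul_one] at this
  refine (injective_iff_map_eq_zero Φ).2 fun φ hφ => Subtype.ext ?_
  have hc : ∀ j m, φ.1 (j - 1) (M.x j m) = N.x j (φ.1 j m) := fun j m =>
    ((homEquiv M N).symm φ).comm_apply j m
  have hone : φ.1 1 = 0 := LinearMap.ext fun m => Subsingleton.elim _ _
  have hzero : φ.1 (1 - 1) = 0 := by
    refine LinearMap.ext fun m => ?_
    have hm : m - s ((LinearMap.range (M.x 1)).mkQ m) ∈ LinearMap.range (M.x 1) := by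
      refine (Submodule.Quotient.mk_eq_zero _).1 ?_
      change (LinearMap.range (M.x 1)).mkQ (m - s ((LinearMap.range (M.x 1)).mkQ m)) = 0
      rw [map_sub]
      exact sub_eq_zero.2 (LinearMap.congr_fun hs _).symm
    obtain ⟨u, hu⟩ := hm
    have h2 := hc 1 u
    rw [hu, hone, map_sub, LinearMap.zero_apply, map_zero, sub_eq_zero] at h2
    exact h2.trans (LinearMap.congr_fun hφ _)
  have key : ∀ i : ℕ, i ≤ n - 2 → φ.1 ((n - i : ℕ) : ZMod n) = 0 := by
    intro i
    induction i with
    | zero =>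
      intro _
      rw [Nat.sub_zero, ZMod.natCast_self, ← sub_self (1 : ZMod n), hzero]
    | succ i ih =>
      intro hi
      have h3 := ih (by omega)
      have h4 : ((n - i : ℕ) : ZMod n) = ((n - (i + 1) : ℕ) : ZMod n) + 1 := by
        rw [show n - i = n - (i + 1) + 1 by omega, Nat.cast_succ]
      rw [h4] at h3
      refine LinearMap.ext fun m => ?_
      have h5 := h (n - (i + 1)) (by omega) (by omega)
      generalize ((n - (i + 1) : ℕ) : ZMod n) = t at *
      obtain ⟨j, rfl⟩ : ∃ j, t = j - 1 := ⟨t + 1, by ring⟩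
      rw [sub_add_cancel] at h3 h5
      obtain ⟨u, rfl⟩ := h5 m
      rw [hc, h3, LinearMap.zero_apply, LinearMap.zero_apply, map_zero]
  funext j
  by_cases hj1 : j = 1
  · subst hj1
    exact hone
  by_cases hj0 : j.val = 0
  · rw [(ZMod.val_eq_zero j).1 hj0, ← sub_self (1 : ZMod n)]
    exact hzero
  · have hj2 : j.val ≠ 1 := fun e => hj1 (by rw [← ZMod.natCast_zmod_val j, e, Nat.cast_one])
    have := j.val_lt
    have h6 := key (n - j.val) (by omega)
    rwa [Nat.sub_sub_self this.le, ZMod.natCast_zmod_val] at h6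

lemma IsUniserial.finrank_ker_diff (hN : N.IsUniserial) (hn : 2 ≤ n) (htot : N.totalDim < n)
    (h : ∀ j : ℕ, 2 ≤ j → j ≤ n - 1 → Function.Bijective (M.x ((j : ZMod n) + 1))) :
    Module.finrank F (LinearMap.ker (diff M N))
      = Module.finrank F (M.V (1 - 1) ⧸ LinearMap.range (M.x 1)) := by
  have h1 := hN.finrank_one_eq_zero htot
  have h0 := hN.dim 1
  rw [if_neg (one_ne_two_of_two_le hn), if_pos rfl, h1] at h0
  refine le_antisymm (finrank_ker_diff_le hn (fun j hj hjn => (h j hj hjn).2) h1 h0) ?_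
  rw [← hN.finrank_add_eq (finrank_eq_of_perp h hn)]
  exact Nat.le_add_left _ _

end

end CRep

open CRep in
/-- Lemma 5.8: for `n ≥ 2`, `a ≥ 1` and a nilpotent representation `M` of `C_n` over
a finite field with `Hom(M,S_j) = 0 = Ext¹(M,S_j)` for `2 ≤ j ≤ n-1`, one has
`Σ_{[N] : ℓ(N) = ℓ(M)+1} |Ext¹(M, S_0^{(an-1)})_N|
  = |Hom(M, S_0^{(an-1)})| / |Hom(M, S_0^{(n-1)})|`. -/
theorem crep_ext_sum_eq_hom_ratio
    (F : Type) [Field F] [Fintype F] (n : ℕ) (hn : 2 ≤ n) [NeZero n]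
    (a : ℕ) (ha : 1 ≤ a)
    (M : CRep F n) (hM : M.IsNilpotentRep)
    (hperp : ∀ j : ℕ, 2 ≤ j → j ≤ n - 1 → ∀ S : CRep F n, IsSja (j : ZMod n) 1 S →
      Subsingleton (Hom M S) ∧ ∀ s : SES S M, s.Splits)
    (k : ℕ) (hk : M.hasLen k)
    (Sb : CRep F n) (hSb : IsSja (0 : ZMod n) (a * n - 1) Sb)
    (Ss : CRep F n) (hSs : IsSja (0 : ZMod n) (n - 1) Ss) :
    (extCount Sb M (fun E => E.hasLen (k + 1)) : ℚ) =
      (homCount M Sb : ℚ) / (homCount M Ss : ℚ) := by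
  have hbij : ∀ j : ℕ, 2 ≤ j → j ≤ n - 1 → Function.Bijective (M.x ((j : ZMod n) + 1)) := by
    intro j hj hjn
    have h := hperp j hj hjn (simple F (((j : ZMod n) + 1) - 1))
      (by rw [add_sub_cancel_right]; exact isSja_simple _)
    exact ⟨injective_of_splits_simple M _ h.2, surjective_of_subsingleton_hom_simple M _ h.1⟩
  have han : n ≤ a * n := Nat.le_mul_of_pos_left n ha
  have hb : Sb.IsUniserial := hSb.isUniserial (by omega) (by
    rw [Nat.cast_sub (by omega), Nat.cast_mul, ZMod.natCast_self, mul_zero, Nat.cast_one,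
      zero_sub])
  have hs : Ss.IsUniserial := hSs.isUniserial (by omega) (by
    rw [Nat.cast_sub (by omega), ZMod.natCast_self, Nat.cast_one, zero_sub])
  have htot : Ss.totalDim < n := by
    rw [IsSja, if_neg (by omega)] at hSs
    rw [hSs.2.2.1]
    omega
  rw [hb.extCount_hasLen hM hk, homCount_eq, homCount_eq, hs.finrank_ker_diff hn htot hbij,
    ← hb.finrank_add_eq (finrank_eq_of_perp hbij hn), pow_add, Nat.cast_mul,
    mul_div_cancel_right₀]
  exact_mod_cast pow_ne_zero _ Nat.card_pos.ne'

end
end
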